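/- arXiv:2408.03883 — 2 statements merged into one kernel-verified Lean document; each statement's English description precedes it below -/
import Mathlib

section
/- (Corollary 5.2, convergence of the inclusion sets for the Jordan block) Suppose ε > 0. Then d_H(Spec_ε V_N, (1+ε)·𝔻̄) → 0 as N → ∞. Moreover, if S_{n,N} denotes any of Π^{n,t}_ε(V_N) (for fixed t ∈ 𝕋), Σ^n_ε(V_N), or Γ^n_ε(V_N), then d_H(S_{n,N}, (1+ε)·𝔻̄) → 0 as n, N → ∞ with n < N, and consequently d_H(S_{n,N}, Spec_ε V_N) → 0 as n, N → ∞ with n < N. -/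
open scoped Real

noncomputable section

namespace SpecInclJL

/-- The smallest singular value of a (possibly rectangular) complex matrix,
as the infimum of `‖F x‖` over the unit sphere. -/
noncomputable def sval {ι κ : Type*} [Fintype ι] [Fintype κ] [DecidableEq κ]
    (F : Matrix ι κ ℂ) : ℝ :=
  sInf {y : ℝ | ∃ x : EuclideanSpace ℂ κ, ‖x‖ = 1 ∧ y = ‖Matrix.toEuclideanLin F x‖}

/-- The closed ε-pseudospectrum of a square complex matrix. -/
noncomputable def pspec {ι : Type*} [Fintype ι] [DecidableEq ι] (ε : ℝ)
    (E : Matrix ι ι ℂ) : Set ℂ :=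
  {z : ℂ | sval (E - z • (1 : Matrix ι ι ℂ)) ≤ ε}

/-- The n×n Jordan block `V_n` (zero diagonal, ones on the superdiagonal). -/
def Vm (n : ℕ) : Matrix (Fin n) (Fin n) ℂ :=
  fun i j => if (i : ℕ) + 1 = (j : ℕ) then 1 else 0

/-- The periodised Jordan block `V^{per,t}_n`: `V_n` plus the entry `t̄` in
position (n,1) (1-based); `V^{per,t}_1 = t̄`. -/
def Vper (n : ℕ) (t : ℂ) : Matrix (Fin n) (Fin n) ℂ :=
  fun i j => (if (i : ℕ) + 1 = (j : ℕ) then 1 else 0)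
    + (if (i : ℕ) = n - 1 ∧ (j : ℕ) = 0 then (starRingEnd ℂ) t else 0)

/-- The (n+2)×n matrix `V⁺_n`: first row `(1,0,…,0)`, middle n rows `V_n`,
last row zero. -/
def VP (n : ℕ) : Matrix (Fin (n + 2)) (Fin n) ℂ :=
  fun i j => if ((i : ℕ) = 0 ∧ (j : ℕ) = 0) ∨
    (1 ≤ (i : ℕ) ∧ (i : ℕ) ≤ n ∧ (j : ℕ) = (i : ℕ)) then 1 else 0

/-- The (n+2)×n matrix `Ṽ⁺_n`: zero first and last rows, middle part `V_n`. -/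
def VtP (n : ℕ) : Matrix (Fin (n + 2)) (Fin n) ℂ :=
  fun i j => if 1 ≤ (i : ℕ) ∧ (i : ℕ) ≤ n ∧ (j : ℕ) = (i : ℕ) then 1 else 0

/-- The (n+2)×n matrix `I⁺_n`: middle part the identity, first and last rows
zero. -/
def IP (n : ℕ) : Matrix (Fin (n + 2)) (Fin n) ℂ :=
  fun i j => if (i : ℕ) = (j : ℕ) + 1 then 1 else 0

/-- The closed ε-pseudospectrum of an (n+2)×n matrix `E⁺`:
`{λ : s_min(E⁺ − λ I⁺_n) ≤ ε}`. -/
noncomputable def pspecR {n : ℕ} (ε : ℝ) (E : Matrix (Fin (n + 2)) (Fin n) ℂ) :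
    Set ℂ :=
  {z : ℂ | sval (E - z • IP n) ≤ ε}

/-- ε_n := 2 sin(π/(4n+2)). -/
noncomputable def epsV (n : ℕ) : ℝ := 2 * Real.sin (Real.pi / (4 * (n : ℝ) + 2))

/-- ε'_n := 2 sin(π/(2n)). -/
noncomputable def epsV' (n : ℕ) : ℝ := 2 * Real.sin (Real.pi / (2 * (n : ℝ)))

/-- ε''_n := 2 sin(π/(2n+2)). -/
noncomputable def epsV'' (n : ℕ) : ℝ := 2 * Real.sin (Real.pi / (2 * (n : ℝ) + 2))

/-- The τ-method inclusion set `Σ^n_ε(V_N)` (independent of `N ≥ n+1`). -/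
noncomputable def SigmaV (n : ℕ) (ε : ℝ) : Set ℂ :=
  if n ≤ 2 then ⋃ m : Fin n, pspec (ε + epsV n) (Vm (m + 1))
  else pspec (ε + epsV (n - 2)) (Vm n) ∩ ⋃ m : Fin n, pspec (ε + epsV n) (Vm (m + 1))

/-- The π-method inclusion set `Π^{n,t}_ε(V_N)`. -/
noncomputable def PiV (n : ℕ) (t : ℂ) (ε : ℝ) : Set ℂ :=
  pspec (ε + epsV' n) (Vm n) ∪ pspec (ε + epsV' n) (Vper n t)

/-- The τ₁-method inclusion set `Γ^n_ε(V_N)`. -/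
noncomputable def GammaV (n : ℕ) (ε : ℝ) : Set ℂ :=
  pspecR (ε + epsV'' n) (VP n) ∪ pspecR (ε + epsV'' n) (VtP n)

/-- The closed disc of radius `r` centred at the origin. -/
def cDisc (r : ℝ) : Set ℂ := {z : ℂ | ‖z‖ ≤ r}

/-- The n×n discrete Laplacian `L_n` (zero diagonal, ones on the first sub-
and superdiagonals). -/
def Lm (n : ℕ) : Matrix (Fin n) (Fin n) ℂ :=
  fun i j => if (i : ℕ) + 1 = (j : ℕ) ∨ (j : ℕ) + 1 = (i : ℕ) then 1 else 0

/-- θ_n for the discrete Laplacian: the unique solution of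
`8 sin(t/2) cos((n+1/2)t) + sin((n−1)t) = 0` in `[π/(2n+1), π/(n+2)]`
(by uniqueness, the infimum of the solution set). -/
noncomputable def thetaL (n : ℕ) : ℝ :=
  sInf {t : ℝ | t ∈ Set.Icc (Real.pi / (2 * (n : ℝ) + 1)) (Real.pi / ((n : ℝ) + 2)) ∧
    8 * Real.sin (t / 2) * Real.cos (((n : ℝ) + 1 / 2) * t)
      + Real.sin (((n : ℝ) - 1) * t) = 0}

/-- ε_n := 4 sin(θ_n/2) for the discrete Laplacian. -/
noncomputable def epsL (n : ℕ) : ℝ := 4 * Real.sin (thetaL n / 2)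

/-- ε''_n := 4 sin(π/(2n+2)) for the discrete Laplacian. -/
noncomputable def epsL'' (n : ℕ) : ℝ := 4 * Real.sin (Real.pi / (2 * (n : ℝ) + 2))

/-- The τ-method inclusion set `Σ^n_ε(L_N)` (independent of `N ≥ n+1`). -/
noncomputable def SigmaL (n : ℕ) (ε : ℝ) : Set ℂ :=
  if n ≤ 2 then ⋃ m : Fin n, pspec (ε + epsL n) (Lm (m + 1))
  else pspec (ε + epsL (n - 2)) (Lm n) ∩ ⋃ m : Fin n, pspec (ε + epsL n) (Lm (m + 1))

/-- The (n+2)×n matrix `L⁺_n`: first row `(1,0,…,0)`, middle n rows `L_n`,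
last row `(0,…,0,1)`. -/
def LP (n : ℕ) : Matrix (Fin (n + 2)) (Fin n) ℂ :=
  fun i j => if ((i : ℕ) = 0 ∧ (j : ℕ) = 0) ∨
      (1 ≤ (i : ℕ) ∧ (i : ℕ) ≤ n ∧ ((j : ℤ) = (i : ℤ) - 2 ∨ (j : ℤ) = (i : ℤ))) ∨
      ((i : ℕ) = n + 1 ∧ (j : ℕ) + 1 = n) then 1 else 0

/-- The (n+2)×n matrix `L̃⁺_n`: first row `(1,0,…,0)`, middle n rows `L_n`,
last row zero. -/
def LtP (n : ℕ) : Matrix (Fin (n + 2)) (Fin n) ℂ :=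
  fun i j => if ((i : ℕ) = 0 ∧ (j : ℕ) = 0) ∨
      (1 ≤ (i : ℕ) ∧ (i : ℕ) ≤ n ∧ ((j : ℤ) = (i : ℤ) - 2 ∨ (j : ℤ) = (i : ℤ)))
    then 1 else 0

/-- The τ₁-method inclusion set `Γ^n_ε(L_N)`. -/
noncomputable def GammaL (N n : ℕ) (ε : ℝ) : Set ℂ :=
  if n = N - 1 then pspecR (ε + epsL'' n) (LtP n)
  else pspecR (ε + epsL'' n) (LP n) ∪ pspecR (ε + epsL'' n) (LtP n)

/-- The set `[−2,2] + ε·𝔻̄ ⊆ ℂ`. -/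
def bandSet (ε : ℝ) : Set ℂ :=
  {z : ℂ | ∃ x : ℝ, x ∈ Set.Icc (-2 : ℝ) 2 ∧ ‖z - (x : ℂ)‖ ≤ ε}

end SpecInclJL

namespace SpecInclJL

section SmallestSingularValue

variable {ι κ : Type*} [Fintype ι] [Fintype κ] [DecidableEq κ]

theorem sval_le_of_norm_le {F : Matrix ι κ ℂ} {η : ℝ} (x : EuclideanSpace ℂ κ) (hx : x ≠ 0)
    (h : ‖Matrix.toEuclideanLin F x‖ ≤ η * ‖x‖) : sval F ≤ η := by
  have hpos : 0 < ‖x‖ := norm_pos_iff.mpr hx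
  have hle : sval F ≤ ‖x‖⁻¹ * ‖Matrix.toEuclideanLin F x‖ := by
    refine csInf_le ⟨0, ?_⟩ ⟨((‖x‖⁻¹ : ℝ) : ℂ) • x, ?_, ?_⟩
    · rintro y ⟨x, -, rfl⟩
      positivity
    · rw [norm_smul, Complex.norm_real, norm_inv, norm_norm, inv_mul_cancel₀ hpos.ne']
    · rw [map_smul, norm_smul, Complex.norm_real, norm_inv, norm_norm]
  refine hle.trans ?_
  rw [inv_mul_le_iff₀ hpos]
  linarith

theorem le_sval [Nonempty κ] {F : Matrix ι κ ℂ} {c : ℝ}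
    (h : ∀ x : EuclideanSpace ℂ κ, c * ‖x‖ ≤ ‖Matrix.toEuclideanLin F x‖) : c ≤ sval F := by
  refine le_csInf ?_ ?_
  · obtain ⟨k⟩ := ‹Nonempty κ›
    exact ⟨_, EuclideanSpace.single k 1, by simp, rfl⟩
  · rintro y ⟨x, hx, rfl⟩
    simpa [hx] using h x

theorem sval_eq_of_norm_eq {ι' : Type*} [Fintype ι'] {F : Matrix ι κ ℂ} {G : Matrix ι' κ ℂ}
    (h : ∀ x, ‖Matrix.toEuclideanLin F x‖ = ‖Matrix.toEuclideanLin G x‖) : sval F = sval G := by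
  simp only [sval, h]

theorem toEuclideanLin_apply_coord {ι : Type*} (F : Matrix ι κ ℂ) (x : EuclideanSpace ℂ κ) (i : ι) :
    Matrix.toEuclideanLin F x i = ∑ j, F i j * x j := rfl

/-- The Schur test: absolute row and column sums at most one force operator norm at most one. -/
theorem norm_toEuclideanLin_le_of_sum_le_one {F : Matrix ι κ ℂ}
    (hrow : ∀ i, ∑ j, ‖F i j‖ ≤ 1) (hcol : ∀ j, ∑ i, ‖F i j‖ ≤ 1) (x : EuclideanSpace ℂ κ) :
    ‖Matrix.toEuclideanLin F x‖ ≤ ‖x‖ := by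
  rw [← sq_le_sq₀ (norm_nonneg _) (norm_nonneg _), EuclideanSpace.norm_sq_eq,
    EuclideanSpace.norm_sq_eq]
  have hi (i : ι) : ‖Matrix.toEuclideanLin F x i‖ ^ 2 ≤ ∑ j, ‖F i j‖ * ‖x j‖ ^ 2 := by
    rw [toEuclideanLin_apply_coord]
    have h₁ : ‖∑ j, F i j * x j‖ ≤ ∑ j, ‖F i j‖ * ‖x j‖ :=
      (norm_sum_le _ _).trans_eq (by simp)
    have h₂ : (∑ j, ‖F i j‖ * ‖x j‖) ^ 2 ≤
        (∑ j, ‖F i j‖) * ∑ j, ‖F i j‖ * ‖x j‖ ^ 2 :=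
      Finset.sum_sq_le_sum_mul_sum_of_sq_le_mul _ (fun _ _ => norm_nonneg _)
        (fun _ _ => by positivity) (fun _ _ => le_of_eq (by ring))
    have h₃ : 0 ≤ ∑ j, ‖F i j‖ * ‖x j‖ ^ 2 := by positivity
    calc ‖∑ j, F i j * x j‖ ^ 2 ≤ (∑ j, ‖F i j‖ * ‖x j‖) ^ 2 := by gcongr
      _ ≤ _ := h₂
      _ ≤ _ := mul_le_of_le_one_left h₃ (hrow i)
  calc ∑ i, ‖Matrix.toEuclideanLin F x i‖ ^ 2
      ≤ ∑ i, ∑ j, ‖F i j‖ * ‖x j‖ ^ 2 := Finset.sum_le_sum fun i _ => hi i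
    _ = ∑ j, (∑ i, ‖F i j‖) * ‖x j‖ ^ 2 := by
        rw [Finset.sum_comm]
        simp only [Finset.sum_mul]
    _ ≤ ∑ j, ‖x j‖ ^ 2 :=
        Finset.sum_le_sum fun j _ => mul_le_of_le_one_left (by positivity) (hcol j)

theorem sum_norm_le_one_of_unique {κ : Type*} [Fintype κ] {f : κ → ℂ} (hf : ∀ j, ‖f j‖ ≤ 1)
    (huniq : ∀ j k, f j ≠ 0 → f k ≠ 0 → j = k) : ∑ j, ‖f j‖ ≤ 1 := by
  by_cases h : ∃ j, f j ≠ 0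
  · obtain ⟨j, hj⟩ := h
    rw [Fintype.sum_eq_single j fun k hk => ?_]
    · exact hf j
    · by_contra hne
      exact hk (huniq k j (by simpa using hne) hj)
  · push Not at h
    simp [h]

/-- A matrix with at most one nonzero entry in each row and column, all of modulus at most one,
is a contraction. -/
theorem norm_toEuclideanLin_le_of_unique {F : Matrix ι κ ℂ} (hF : ∀ i j, ‖F i j‖ ≤ 1)
    (hrow : ∀ i j k, F i j ≠ 0 → F i k ≠ 0 → j = k)
    (hcol : ∀ i k j, F i j ≠ 0 → F k j ≠ 0 → i = k) (x : EuclideanSpace ℂ κ) :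
    ‖Matrix.toEuclideanLin F x‖ ≤ ‖x‖ :=
  norm_toEuclideanLin_le_of_sum_le_one
    (fun i => sum_norm_le_one_of_unique (hF i) (hrow i))
    (fun j => sum_norm_le_one_of_unique (fun i => hF i j) fun i k => hcol i k j) x

theorem norm_sub_one_le_sval_sub_smul [Nonempty κ] {E J : Matrix ι κ ℂ}
    (hE : ∀ x, ‖Matrix.toEuclideanLin E x‖ ≤ ‖x‖)
    (hJ : ∀ x, ‖Matrix.toEuclideanLin J x‖ = ‖x‖) (z : ℂ) :
    ‖z‖ - 1 ≤ sval (E - z • J) := by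
  refine le_sval fun x => ?_
  rw [map_sub, map_smul, LinearMap.sub_apply, LinearMap.smul_apply]
  have h := norm_sub_norm_le (z • Matrix.toEuclideanLin J x) (Matrix.toEuclideanLin E x)
  rw [norm_smul, hJ, norm_sub_rev] at h
  linarith [hE x]

theorem norm_toEuclideanLin_one (x : EuclideanSpace ℂ κ) :
    ‖Matrix.toEuclideanLin (1 : Matrix κ κ ℂ) x‖ = ‖x‖ := by
  simp

theorem pspec_subset_cDisc [Nonempty κ] {E : Matrix κ κ ℂ}
    (hE : ∀ x, ‖Matrix.toEuclideanLin E x‖ ≤ ‖x‖) (η : ℝ) : pspec η E ⊆ cDisc (1 + η) := by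
  intro z (hz : sval _ ≤ η)
  have := norm_sub_one_le_sval_sub_smul hE norm_toEuclideanLin_one z
  change ‖z‖ ≤ 1 + η
  linarith

theorem pspec_mono (E : Matrix κ κ ℂ) {η η' : ℝ} (h : η ≤ η') : pspec η E ⊆ pspec η' E :=
  fun _ hz => le_trans (show sval _ ≤ η from hz) h

end SmallestSingularValue

theorem norm_Vm_le {n : ℕ} (x : EuclideanSpace ℂ (Fin n)) :
    ‖Matrix.toEuclideanLin (Vm n) x‖ ≤ ‖x‖ := by
  refine norm_toEuclideanLin_le_of_unique (fun i j => ?_) (fun i j k h h' => ?_)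
    (fun i k j h h' => ?_) x
  · unfold Vm
    split_ifs <;> simp
  all_goals
    simp only [Vm, ne_eq, ite_eq_right_iff, one_ne_zero, imp_false, not_not] at h h'
    omega

theorem norm_Vper_le {n : ℕ} {t : ℂ} (ht : ‖t‖ = 1) (x : EuclideanSpace ℂ (Fin n)) :
    ‖Matrix.toEuclideanLin (Vper n t) x‖ ≤ ‖x‖ := by
  have hne {i j : Fin n} (h : Vper n t i j ≠ 0) :
      (i : ℕ) + 1 = j ∨ (i : ℕ) = n - 1 ∧ (j : ℕ) = 0 := by
    by_contra hc
    rw [not_or] at hc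
    exact h (by simp only [Vper, if_neg hc.1, if_neg hc.2, add_zero])
  refine norm_toEuclideanLin_le_of_unique (fun i j => ?_) (fun i j k h h' => ?_)
    (fun i k j h h' => ?_) x
  · unfold Vper
    split_ifs
    · omega
    all_goals simp [ht]
  all_goals
    have := hne h
    have := hne h'
    omega

theorem norm_VP_le {n : ℕ} (x : EuclideanSpace ℂ (Fin n)) :
    ‖Matrix.toEuclideanLin (VP n) x‖ ≤ ‖x‖ := by
  refine norm_toEuclideanLin_le_of_unique (fun i j => ?_) (fun i j k h h' => ?_)
    (fun i k j h h' => ?_) x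
  · unfold VP
    split_ifs <;> simp
  all_goals
    simp only [VP, ne_eq, ite_eq_right_iff, one_ne_zero, imp_false, not_not] at h h'
    omega

/-- Zero first and last rows do not affect norms of images. -/
theorem norm_toEuclideanLin_eq_of_zero_rows {n : ℕ} {F : Matrix (Fin (n + 2)) (Fin n) ℂ}
    {G : Matrix (Fin n) (Fin n) ℂ} (hzero : ∀ j, F 0 j = 0)
    (hlast : ∀ j, F (Fin.last (n + 1)) j = 0) (hmid : ∀ i j, F i.castSucc.succ j = G i j)
    (x : EuclideanSpace ℂ (Fin n)) :
    ‖Matrix.toEuclideanLin F x‖ = ‖Matrix.toEuclideanLin G x‖ := by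
  rw [EuclideanSpace.norm_eq, EuclideanSpace.norm_eq, Fin.sum_univ_succ, Fin.sum_univ_castSucc]
  simp [toEuclideanLin_apply_coord, hzero, hlast, hmid]

theorem IP_zero {n : ℕ} (j : Fin n) : IP n 0 j = 0 := by simp [IP]

theorem IP_last {n : ℕ} (j : Fin n) : IP n (Fin.last (n + 1)) j = 0 := by
  simp [IP, j.isLt.ne']

theorem IP_middle {n : ℕ} (i j : Fin n) : IP n i.castSucc.succ j = (1 : Matrix _ _ ℂ) i j := by
  simp [IP, Matrix.one_apply, Fin.ext_iff]

theorem norm_IP {n : ℕ} (x : EuclideanSpace ℂ (Fin n)) :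
    ‖Matrix.toEuclideanLin (IP n) x‖ = ‖x‖ := by
  rw [norm_toEuclideanLin_eq_of_zero_rows IP_zero IP_last IP_middle, norm_toEuclideanLin_one]

theorem pspecR_VtP (n : ℕ) (η : ℝ) : pspecR η (VtP n) = pspec η (Vm n) := by
  ext z
  change sval _ ≤ η ↔ sval _ ≤ η
  rw [sval_eq_of_norm_eq (norm_toEuclideanLin_eq_of_zero_rows (fun j => ?_) (fun j => ?_)
    fun i j => ?_)]
  · simp [IP_zero, VtP]
  · simp [IP_last, VtP]
  · have h : VtP n i.castSucc.succ j = Vm n i j := by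
      simp only [VtP, Vm, Fin.val_succ, Fin.val_castSucc]
      congr 1
      rw [eq_iff_iff]
      omega
    simp [IP_middle, h]

theorem pspecR_VP_subset_cDisc {n : ℕ} [NeZero n] (η : ℝ) : pspecR η (VP n) ⊆ cDisc (1 + η) := by
  intro z (hz : sval _ ≤ η)
  have := norm_sub_one_le_sval_sub_smul (norm_VP_le (n := n)) norm_IP z
  change ‖z‖ ≤ 1 + η
  linarith

/-- The geometric vector `(1, w, …, w^{n-1})`. -/
def geomVec (n : ℕ) (w : ℂ) : EuclideanSpace ℂ (Fin n) := WithLp.toLp 2 fun j => w ^ (j : ℕ)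

theorem Vm_geomVec (n : ℕ) (w : ℂ) :
    Matrix.toEuclideanLin (Vm (n + 1)) (geomVec (n + 1) w) =
      w • geomVec (n + 1) w - EuclideanSpace.single (Fin.last n) (w ^ (n + 1)) := by
  ext i
  rw [toEuclideanLin_apply_coord]
  induction i using Fin.lastCases with
  | last =>
    have h (j : Fin (n + 1)) : ¬ n + 1 = (j : ℕ) := by omega
    simp [Vm, geomVec, h, pow_succ']
  | cast i =>
    rw [Fintype.sum_eq_single i.succ fun j hj => ?_]
    · simp [Vm, geomVec, pow_succ', i.castSucc_lt_last.ne]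
    · have h : ¬ (i : ℕ) + 1 = (j : ℕ) := fun h => hj (Fin.ext (by simp [h]))
      simp [Vm, h]

theorem sqrt_mul_pow_le_norm_geomVec (n : ℕ) {w : ℂ} (hw : ‖w‖ ≤ 1) :
    √n * ‖w‖ ^ n ≤ ‖geomVec n w‖ := by
  rw [EuclideanSpace.norm_eq]
  refine Real.le_sqrt_of_sq_le ?_
  rw [mul_pow, Real.sq_sqrt (Nat.cast_nonneg n)]
  calc (n : ℝ) * (‖w‖ ^ n) ^ 2 = ∑ _j : Fin n, (‖w‖ ^ n) ^ 2 := by simp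
    _ ≤ ∑ j, ‖geomVec n w j‖ ^ 2 := Finset.sum_le_sum fun j _ => by
        simp only [geomVec, norm_pow]
        gcongr ?_ ^ 2
        exact pow_le_pow_of_le_one (norm_nonneg w) hw j.isLt.le

theorem sval_Vm_sub_smul_le {n : ℕ} (hn : n ≠ 0) {w : ℂ} (hw : ‖w‖ ≤ 1) (z : ℂ) :
    sval (Vm n - z • (1 : Matrix (Fin n) (Fin n) ℂ)) ≤ 1 / √n + ‖z - w‖ := by
  obtain ⟨n, rfl⟩ := Nat.exists_eq_succ_of_ne_zero hn
  have hsqrt : 0 < √((n + 1 : ℕ) : ℝ) := Real.sqrt_pos.mpr (by positivity)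
  refine sval_le_of_norm_le (geomVec (n + 1) w) (fun h => ?_) ?_
  · simpa [geomVec] using congrArg (fun v : EuclideanSpace ℂ (Fin (n + 1)) => v 0) h
  · have hone : Matrix.toEuclideanLin (1 : Matrix (Fin (n + 1)) (Fin (n + 1)) ℂ)
        (geomVec (n + 1) w) = geomVec (n + 1) w := by
      simp
    rw [map_sub, map_smul, LinearMap.sub_apply, LinearMap.smul_apply, hone, Vm_geomVec]
    have hsplit : w • geomVec (n + 1) w - EuclideanSpace.single (Fin.last n) (w ^ (n + 1)) -
        z • geomVec (n + 1) w = -(EuclideanSpace.single (Fin.last n) (w ^ (n + 1)) +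
          (z - w) • geomVec (n + 1) w) := by
      rw [sub_smul]
      abel
    rw [hsplit, norm_neg, add_mul]
    refine (norm_add_le _ _).trans (add_le_add ?_ (norm_smul_le _ _))
    rw [PiLp.norm_single, norm_pow, one_div, ← div_eq_inv_mul, le_div_iff₀' hsqrt]
    exact sqrt_mul_pow_le_norm_geomVec (n + 1) hw

/-- A point of a larger disc is within the difference of the radii of the smaller disc. -/
theorem exists_mem_cDisc_dist_le {r d : ℝ} (hr : 0 ≤ r) (hd : 0 ≤ d) {z : ℂ}
    (hz : z ∈ cDisc (r + d)) : ∃ w ∈ cDisc r, dist z w ≤ d := by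
  change ‖z‖ ≤ r + d at hz
  by_cases h : ‖z‖ ≤ r
  · exact ⟨z, h, by simpa⟩
  · push Not at h
    have hpos : 0 < ‖z‖ := hr.trans_lt h
    refine ⟨((r / ‖z‖ : ℝ) : ℂ) * z, ?_, ?_⟩
    · change ‖_‖ ≤ r
      rw [norm_mul, Complex.norm_real, Real.norm_of_nonneg (by positivity),
        div_mul_cancel₀ _ hpos.ne']
    · have h₁ : z - ((r / ‖z‖ : ℝ) : ℂ) * z = ((1 - r / ‖z‖ : ℝ) : ℂ) * z := by
        push_cast
        ring
      have h₂ : 0 ≤ 1 - r / ‖z‖ := by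
        rw [sub_nonneg, div_le_one hpos]
        exact h.le
      rw [dist_eq_norm, h₁, norm_mul, Complex.norm_real, Real.norm_of_nonneg h₂, sub_mul,
        div_mul_cancel₀ _ hpos.ne']
      linarith

theorem cDisc_mono {r s : ℝ} (h : r ≤ s) : cDisc r ⊆ cDisc s :=
  fun _ hz => le_trans (show ‖_‖ ≤ r from hz) h

theorem cDisc_subset_pspec_Vm {ε d : ℝ} (hd : d ≤ ε) {n : ℕ} (hn : n ≠ 0) (hnd : 1 / √n ≤ d) :
    cDisc (1 + ε - d) ⊆ pspec ε (Vm n) := by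
  intro z hz
  rw [add_sub_assoc] at hz
  obtain ⟨w, hw, hzw⟩ := exists_mem_cDisc_dist_le zero_le_one (sub_nonneg.mpr hd) hz
  rw [dist_eq_norm] at hzw
  exact (sval_Vm_sub_smul_le hn hw z).trans (by linarith)

theorem hausdorffDist_le_of_cDisc_subset {r d : ℝ} (hd : 0 ≤ d) (hdr : d ≤ r) {S T : Set ℂ}
    (hS : cDisc (r - d) ⊆ S) (hS' : S ⊆ cDisc (r + d))
    (hT : cDisc (r - d) ⊆ T) (hT' : T ⊆ cDisc (r + d)) :
    Metric.hausdorffDist S T ≤ 2 * d := by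
  have key {A B : Set ℂ} (hA : A ⊆ cDisc (r + d)) (hB : cDisc (r - d) ⊆ B) :
      ∀ x ∈ A, ∃ y ∈ B, dist x y ≤ 2 * d := by
    intro x hx
    have hx' : x ∈ cDisc ((r - d) + 2 * d) := by
      convert hA hx using 2
      ring
    obtain ⟨y, hy, hxy⟩ := exists_mem_cDisc_dist_le (sub_nonneg.mpr hdr) (by positivity) hx'
    exact ⟨y, hB hy, hxy⟩
  exact Metric.hausdorffDist_le_of_mem_dist (by positivity) (key hS' hT) (key hT' hS)

open Filter in
/-- Convergence of a sequence of sets to a disc, in the form of two-sided inclusions. -/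
theorem exists_hausdorffDist_le {ε : ℝ} (hε : 0 < ε) {S : ℕ → Set ℂ} {b : ℕ → ℝ}
    (hb : Tendsto b atTop (nhds 0))
    (hS : ∀ᶠ n in atTop, pspec ε (Vm n) ⊆ S n ∧ S n ⊆ cDisc (1 + ε + b n)) {δ : ℝ} (hδ : 0 < δ) :
    ∃ n₀ : ℕ, ∀ n N : ℕ, n₀ ≤ n → n < N →
      Metric.hausdorffDist (S n) (cDisc (1 + ε)) ≤ δ ∧
      Metric.hausdorffDist (S n) (pspec ε (Vm N)) ≤ δ := by
  obtain ⟨d, hd, hdε, hdδ⟩ : ∃ d, 0 < d ∧ d ≤ ε ∧ 2 * d ≤ δ :=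
    ⟨min ε (δ / 2), by positivity, min_le_left _ _, by linarith [min_le_right ε (δ / 2)]⟩
  have hsqrt : Tendsto (fun n : ℕ => 1 / √(n : ℝ)) atTop (nhds 0) := by
    simpa only [one_div, Function.comp_def] using
      tendsto_inv_atTop_zero.comp (Real.tendsto_sqrt_atTop.comp tendsto_natCast_atTop_atTop)
  obtain ⟨n₀, h₀⟩ := eventually_atTop.mp (hS.and
    ((hb.eventually (eventually_le_nhds hd)).and
      ((hsqrt.eventually (eventually_le_nhds hd)).and (eventually_ne_atTop 0))))
  refine ⟨n₀, fun n N hn hN => ?_⟩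
  obtain ⟨⟨hlow, hup⟩, hbn, hnd, hn0⟩ := h₀ n hn
  obtain ⟨-, -, hNd, hN0⟩ := h₀ N (hn.trans hN.le)
  have hSl := (cDisc_subset_pspec_Vm hdε hn0 hnd).trans hlow
  have hSu : S n ⊆ cDisc (1 + ε + d) := hup.trans (cDisc_mono (by linarith))
  have hr : d ≤ 1 + ε := by linarith
  have : NeZero N := ⟨hN0⟩
  constructor
  · exact (hausdorffDist_le_of_cDisc_subset hd.le hr hSl hSu (cDisc_mono (by linarith))
      (cDisc_mono (by linarith))).trans hdδ
  · exact (hausdorffDist_le_of_cDisc_subset hd.le hr hSl hSu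
      (cDisc_subset_pspec_Vm hdε hN0 hNd)
      ((pspec_subset_cDisc norm_Vm_le ε).trans (cDisc_mono (by linarith)))).trans hdδ

theorem two_mul_sin_pi_div_nonneg {x : ℝ} (hx : 1 ≤ x) : 0 ≤ 2 * Real.sin (π / x) :=
  mul_nonneg zero_le_two (Real.sin_nonneg_of_nonneg_of_le_pi (by positivity)
    (div_le_self Real.pi_pos.le hx))

open Filter in
theorem tendsto_two_mul_sin_pi_div {f : ℕ → ℝ} (hf : ∀ n : ℕ, (n : ℝ) ≤ f n) :
    Tendsto (fun n => 2 * Real.sin (π / f n)) atTop (nhds 0) := by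
  have h : Tendsto (fun n => π / f n) atTop (nhds 0) :=
    tendsto_const_nhds.div_atTop (tendsto_atTop_mono hf (tendsto_natCast_atTop_atTop (R := ℝ)))
  simpa using ((Real.continuous_sin.tendsto 0).comp h).const_mul 2

open Filter in
theorem tendsto_epsV : Tendsto epsV atTop (nhds 0) :=
  tendsto_two_mul_sin_pi_div fun n => by linarith [(Nat.cast_nonneg n : (0 : ℝ) ≤ n)]

open Filter in
theorem tendsto_epsV' : Tendsto epsV' atTop (nhds 0) :=
  tendsto_two_mul_sin_pi_div fun n => by linarith [(Nat.cast_nonneg n : (0 : ℝ) ≤ n)]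

open Filter in
theorem tendsto_epsV'' : Tendsto epsV'' atTop (nhds 0) :=
  tendsto_two_mul_sin_pi_div fun n => by linarith [(Nat.cast_nonneg n : (0 : ℝ) ≤ n)]

theorem epsV_nonneg (n : ℕ) : 0 ≤ epsV n :=
  two_mul_sin_pi_div_nonneg (by linarith [(Nat.cast_nonneg n : (0 : ℝ) ≤ n)])

theorem epsV'_nonneg {n : ℕ} (hn : n ≠ 0) : 0 ≤ epsV' n :=
  two_mul_sin_pi_div_nonneg (by
    linarith [(Nat.one_le_cast.mpr (Nat.one_le_iff_ne_zero.mpr hn) : (1 : ℝ) ≤ n)])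

theorem epsV''_nonneg (n : ℕ) : 0 ≤ epsV'' n :=
  two_mul_sin_pi_div_nonneg (by linarith [(Nat.cast_nonneg n : (0 : ℝ) ≤ n)])

theorem pspec_subset_PiV_subset (ε : ℝ) {t : ℂ} (ht : ‖t‖ = 1) {n : ℕ} (hn : n ≠ 0) :
    pspec ε (Vm n) ⊆ PiV n t ε ∧ PiV n t ε ⊆ cDisc (1 + ε + epsV' n) := by
  have : NeZero n := ⟨hn⟩
  rw [add_assoc]
  exact ⟨(pspec_mono _ (by linarith [epsV'_nonneg hn])).trans Set.subset_union_left,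
    Set.union_subset (pspec_subset_cDisc norm_Vm_le _)
      (pspec_subset_cDisc (norm_Vper_le ht) _)⟩

theorem pspec_subset_SigmaV_subset (ε : ℝ) {n : ℕ} (hn : 2 < n) :
    pspec ε (Vm n) ⊆ SigmaV n ε ∧ SigmaV n ε ⊆ cDisc (1 + ε + epsV (n - 2)) := by
  have : NeZero n := ⟨by omega⟩
  rw [add_assoc, SigmaV, if_neg hn.not_ge]
  refine ⟨Set.subset_inter (pspec_mono _ (by linarith [epsV_nonneg (n - 2)])) ?_,
    Set.inter_subset_left.trans (pspec_subset_cDisc norm_Vm_le _)⟩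
  obtain ⟨k, rfl⟩ := Nat.exists_eq_add_one_of_ne_zero (NeZero.ne n)
  exact (pspec_mono _ (by linarith [epsV_nonneg (k + 1)])).trans
    (Set.subset_iUnion (fun m : Fin (k + 1) => pspec (ε + epsV (k + 1)) (Vm (m + 1)))
      (Fin.last k))

theorem pspec_subset_GammaV_subset (ε : ℝ) {n : ℕ} (hn : n ≠ 0) :
    pspec ε (Vm n) ⊆ GammaV n ε ∧ GammaV n ε ⊆ cDisc (1 + ε + epsV'' n) := by
  have : NeZero n := ⟨hn⟩
  rw [add_assoc, GammaV, pspecR_VtP]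
  exact ⟨(pspec_mono _ (by linarith [epsV''_nonneg n])).trans Set.subset_union_right,
    Set.union_subset (pspecR_VP_subset_cDisc _) (pspec_subset_cDisc norm_Vm_le _)⟩

end SpecInclJL

open SpecInclJL in
/-- **Corollary 5.2 (convergence of the inclusion sets for the Jordan
block).** For ε > 0: `Spec_ε V_N → (1+ε)𝔻̄` in Hausdorff distance as
`N → ∞`; each of `Π^{n,t}_ε(V_N)`, `Σ^n_ε(V_N)`, `Γ^n_ε(V_N)` converges to
`(1+ε)𝔻̄` as `n, N → ∞` with `n < N`; and consequently each converges to
`Spec_ε V_N` in Hausdorff distance as `n, N → ∞` with `n < N`. -/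
theorem jordan_inclusion_sets_convergence (ε : ℝ) (hε : 0 < ε) :
    Filter.Tendsto
      (fun N : ℕ => Metric.hausdorffDist (pspec ε (Vm N)) (cDisc (1 + ε)))
      Filter.atTop (nhds 0) ∧
    (∀ t : ℂ, ‖t‖ = 1 → ∀ δ : ℝ, 0 < δ → ∃ n₀ : ℕ, ∀ n N : ℕ, n₀ ≤ n → n < N →
      Metric.hausdorffDist (PiV n t ε) (cDisc (1 + ε)) ≤ δ ∧
      Metric.hausdorffDist (PiV n t ε) (pspec ε (Vm N)) ≤ δ) ∧
    (∀ δ : ℝ, 0 < δ → ∃ n₀ : ℕ, ∀ n N : ℕ, n₀ ≤ n → n < N →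
      Metric.hausdorffDist (SigmaV n ε) (cDisc (1 + ε)) ≤ δ ∧
      Metric.hausdorffDist (SigmaV n ε) (pspec ε (Vm N)) ≤ δ) ∧
    (∀ δ : ℝ, 0 < δ → ∃ n₀ : ℕ, ∀ n N : ℕ, n₀ ≤ n → n < N →
      Metric.hausdorffDist (GammaV n ε) (cDisc (1 + ε)) ≤ δ ∧
      Metric.hausdorffDist (GammaV n ε) (pspec ε (Vm N)) ≤ δ) := by
  refine ⟨?_, fun t ht δ hδ => ?_, fun δ hδ => ?_, fun δ hδ => ?_⟩
  · rw [Metric.tendsto_atTop]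
    intro δ hδ
    obtain ⟨n₀, h₀⟩ := exists_hausdorffDist_le hε (S := fun n => pspec ε (Vm n)) (b := 0)
      tendsto_const_nhds (by
        filter_upwards [Filter.eventually_ne_atTop 0] with n hn
        have : NeZero n := ⟨hn⟩
        simpa using pspec_subset_cDisc norm_Vm_le ε) (half_pos hδ)
    refine ⟨n₀, fun n hn => ?_⟩
    rw [Real.dist_0_eq_abs, abs_of_nonneg Metric.hausdorffDist_nonneg]
    linarith [(h₀ n (n + 1) hn n.lt_succ_self).1]
  · refine exists_hausdorffDist_le hε (S := fun n => PiV n t ε) (b := epsV')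
      tendsto_epsV' ?_ hδ
    filter_upwards [Filter.eventually_ne_atTop 0] with n hn
    exact pspec_subset_PiV_subset ε ht hn
  · refine exists_hausdorffDist_le hε (S := fun n => SigmaV n ε) (b := fun n => epsV (n - 2))
      (tendsto_epsV.comp (Filter.tendsto_sub_atTop_nat 2)) ?_ hδ
    filter_upwards [Filter.eventually_gt_atTop 2] with n hn
    exact pspec_subset_SigmaV_subset ε hn
  · refine exists_hausdorffDist_le hε (S := fun n => GammaV n ε) (b := epsV'')
      tendsto_epsV'' ?_ hδ
    filter_upwards [Filter.eventually_ne_atTop 0] with n hn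
    exact pspec_subset_GammaV_subset ε hn
end
end

section
/- (Theorem 5.4, sharpness of the τ-method inclusion sets for banded Toeplitz matrices) Suppose ε > 0. Then: (i) d_H(Spec_ε A_M, Spec_ε A_∞) → 0 as M → ∞; (ii) for every δ > 0 there exists n_0 ∈ ℕ such that d_H(Σ^n_ε(A_M), Spec_ε A_∞) ≤ δ whenever n ≥ n_0, M ∈ ℕ, and A_M is written in an admissible block form with m_i ≥ w_M for all i and N > n; consequently d_H(Σ^n_ε(A_M), Spec_ε A_M) → 0 as M, n → ∞ with N > n. If in addition a_{−j} = conj(a_j) for all j ∈ ℤ, then all of these conclusions hold also for ε = 0; in particular d_H(Σ^n_0(A_M), Spec A_M) → 0 as M, n → ∞. -/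
open scoped Real

noncomputable section

namespace SpecIncl

/-- The smallest singular value of a (possibly rectangular) complex matrix,
as the infimum of `‖F x‖` over the unit sphere. -/
noncomputable def sval {ι κ : Type*} [Fintype ι] [Fintype κ] [DecidableEq κ]
    (F : Matrix ι κ ℂ) : ℝ :=
  sInf {y : ℝ | ∃ x : EuclideanSpace ℂ κ, ‖x‖ = 1 ∧ y = ‖Matrix.toEuclideanLin F x‖}

/-- The spectral norm (2-norm) of a complex matrix. -/
noncomputable def opNorm {ι κ : Type*} [Fintype ι] [Fintype κ] [DecidableEq κ]
    (F : Matrix ι κ ℂ) : ℝ :=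
  sSup {y : ℝ | ∃ x : EuclideanSpace ℂ κ, ‖x‖ = 1 ∧ y = ‖Matrix.toEuclideanLin F x‖}

/-- The closed ε-pseudospectrum of a square complex matrix. -/
noncomputable def pspec {ι : Type*} [Fintype ι] [DecidableEq ι] (ε : ℝ)
    (E : Matrix ι ι ℂ) : Set ℂ :=
  {z : ℂ | sval (E - z • (1 : Matrix ι ι ℂ)) ≤ ε}

/-- Assemble blocks into a block matrix indexed by a sigma type. -/
def blockMat {N : ℕ} (m : Fin N → ℕ)
    (a : ∀ i j : Fin N, Matrix (Fin (m i)) (Fin (m j)) ℂ) :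
    Matrix ((i : Fin N) × Fin (m i)) ((j : Fin N) × Fin (m j)) ℂ :=
  fun p q => a p.1 q.1 p.2 q.2

/-- The block-tridiagonal part of a block matrix. -/
def triPart {N : ℕ} {m : Fin N → ℕ}
    (a : ∀ i j : Fin N, Matrix (Fin (m i)) (Fin (m j)) ℂ) :
    ∀ i j : Fin N, Matrix (Fin (m i)) (Fin (m j)) ℂ :=
  fun i j => if |(i : ℤ) - (j : ℤ)| ≤ 1 then a i j else 0

/-- The remaining (off-tridiagonal) part of a block matrix. -/
def remPart {N : ℕ} {m : Fin N → ℕ}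
    (a : ∀ i j : Fin N, Matrix (Fin (m i)) (Fin (m j)) ℂ) :
    ∀ i j : Fin N, Matrix (Fin (m i)) (Fin (m j)) ℂ :=
  fun i j => if |(i : ℤ) - (j : ℤ)| ≤ 1 then 0 else a i j

/-- r_L(A): max of the norms of the first-subdiagonal blocks. -/
noncomputable def rL {N : ℕ} {m : Fin N → ℕ}
    (a : ∀ i j : Fin N, Matrix (Fin (m i)) (Fin (m j)) ℂ) : ℝ :=
  sSup {y : ℝ | ∃ i j : Fin N, (j : ℕ) + 1 = (i : ℕ) ∧ y = opNorm (a i j)}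

/-- r_U(A): max of the norms of the first-superdiagonal blocks. -/
noncomputable def rU {N : ℕ} {m : Fin N → ℕ}
    (a : ∀ i j : Fin N, Matrix (Fin (m i)) (Fin (m j)) ℂ) : ℝ :=
  sSup {y : ℝ | ∃ i j : Fin N, (i : ℕ) + 1 = (j : ℕ) ∧ y = opNorm (a i j)}

noncomputable def rA {N : ℕ} {m : Fin N → ℕ}
    (a : ∀ i j : Fin N, Matrix (Fin (m i)) (Fin (m j)) ℂ) : ℝ :=
  rL a + rU a

/-- θ_n for the coefficient `c = r_L r_U / r²`: the unique solution of
`2 sin(t/2) cos((n+1/2)t) + c sin((n−1)t) = 0` in `[π/(2n+1), π/(n+2)]`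
(by uniqueness, equal to the infimum of the solution set). -/
noncomputable def theta (c : ℝ) (n : ℕ) : ℝ :=
  sInf {t : ℝ | t ∈ Set.Icc (Real.pi / (2 * (n : ℝ) + 1)) (Real.pi / ((n : ℝ) + 2)) ∧
    2 * Real.sin (t / 2) * Real.cos (((n : ℝ) + 1 / 2) * t)
      + c * Real.sin (((n : ℝ) - 1) * t) = 0}

/-- ε_n(A) := 2 r(A) sin(θ_n(A)/2) + ‖C‖. -/
noncomputable def epsTau {N : ℕ} {m : Fin N → ℕ}
    (a : ∀ i j : Fin N, Matrix (Fin (m i)) (Fin (m j)) ℂ) (n : ℕ) : ℝ :=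
  2 * rA a * Real.sin (theta (rL a * rU a / (rA a) ^ 2) n / 2)
    + opNorm (blockMat m (remPart a))

/-- The index `k + i` in `Fin N` (0-based window of length `n` starting at `k`). -/
def widx {N n k : ℕ} (h : k + n ≤ N) (i : Fin n) : Fin N :=
  ⟨k + i, by have := i.isLt; omega⟩

/-- The principal submatrix `B_{n,k}` of a block matrix, with block rows and
columns `k+1,…,k+n` (1-based), i.e. `k,…,k+n-1` (0-based). -/
def window {N : ℕ} {m : Fin N → ℕ}
    (b : ∀ i j : Fin N, Matrix (Fin (m i)) (Fin (m j)) ℂ)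
    (n k : ℕ) (h : k + n ≤ N) :
    Matrix ((i : Fin n) × Fin (m (widx h i))) ((j : Fin n) × Fin (m (widx h j))) ℂ :=
  fun p q => b (widx h p.1) (widx h q.1) p.2 q.2

/-- σ^n_ε(A) of the τ-method. -/
noncomputable def sigmaLow {N : ℕ} {m : Fin N → ℕ}
    (a : ∀ i j : Fin N, Matrix (Fin (m i)) (Fin (m j)) ℂ)
    (n : ℕ) (h : n ≤ N) (ε : ℝ) : Set ℂ :=
  (⋃ k : Fin (N - n + 1),
      pspec (ε + epsTau a n)
        (window (triPart a) n k (by have := k.isLt; omega))) ∪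
  (⋃ m' : Fin (n - 1),
      pspec (ε + epsTau a n)
        (window (triPart a) (m' + 1) 0 (by have := m'.isLt; omega)) ∪
      pspec (ε + epsTau a n)
        (window (triPart a) (m' + 1) (N - (m' + 1)) (by have := m'.isLt; omega)))

/-- σ̂^n_ε(A) of the τ-method. -/
noncomputable def sigmaHat {N : ℕ} {m : Fin N → ℕ}
    (a : ∀ i j : Fin N, Matrix (Fin (m i)) (Fin (m j)) ℂ)
    (n : ℕ) (h : n ≤ N) (ε : ℝ) : Set ℂ :=
  ⋃ k : Fin (N - n + 1),
    pspec (ε + epsTau a (n - 2))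
      (window (triPart a) n k (by have := k.isLt; omega))

/-- The τ-method inclusion set Σ^n_ε(A). -/
noncomputable def SigmaTau {N : ℕ} {m : Fin N → ℕ}
    (a : ∀ i j : Fin N, Matrix (Fin (m i)) (Fin (m j)) ℂ)
    (n : ℕ) (h : n ≤ N) (ε : ℝ) : Set ℂ :=
  if n ≤ 2 then sigmaLow a n h ε else sigmaLow a n h ε ∩ sigmaHat a n h ε


/-- The row size of the extended block structure: `m i` for `0 ≤ i < N`
(0-based), and `1` (the paper's `1 × m` zero-block convention) otherwise. -/
def rsz {N : ℕ} (m : Fin N → ℕ) (i : ℤ) : ℕ :=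
  if h : 0 ≤ i ∧ i < N then m ⟨i.toNat, by omega⟩ else 1

/-- Scalar access to a block matrix extended by zeros outside the index
range `{0,…,N−1}` (0-based). -/
noncomputable def sb {N : ℕ} {m : Fin N → ℕ}
    (b : ∀ i j : Fin N, Matrix (Fin (m i)) (Fin (m j)) ℂ)
    (i j : ℤ) (α β : ℕ) : ℂ :=
  if hi : 0 ≤ i ∧ i < N then
    if hj : 0 ≤ j ∧ j < N then
      if hα : α < m ⟨i.toNat, by omega⟩ then
        if hβ : β < m ⟨j.toNat, by omega⟩ then
          b ⟨i.toNat, by omega⟩ ⟨j.toNat, by omega⟩ ⟨α, hα⟩ ⟨β, hβ⟩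
        else 0
      else 0
    else 0
  else 0

/-- The rectangular one-sided truncation `B^+_{n,k}`: the `(n+2) × n` block
matrix with first block row `(b_{k,k+1}, 0, …, 0)`, middle part `B_{n,k}`, and
last block row `(0, …, 0, b_{k+n+1,k+n})` (1-based indices as in the paper). -/
noncomputable def Bplus {N : ℕ} {m : Fin N → ℕ}
    (b : ∀ i j : Fin N, Matrix (Fin (m i)) (Fin (m j)) ℂ)
    (n k : ℕ) (h : k + n ≤ N) :
    Matrix ((i : Fin (n + 2)) × Fin (rsz m ((k : ℤ) - 1 + i)))
      ((j : Fin n) × Fin (m (widx h j))) ℂ :=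
  fun p q => sb b ((k : ℤ) - 1 + p.1) ((k : ℤ) + q.1) p.2 q.2

/-- The rectangular matrix `I⁺_n` whose middle `n × n` block part is the
identity and whose first and last block rows are zero. -/
noncomputable def IplusMat {N : ℕ} (m : Fin N → ℕ)
    (n k : ℕ) (h : k + n ≤ N) :
    Matrix ((i : Fin (n + 2)) × Fin (rsz m ((k : ℤ) - 1 + i)))
      ((j : Fin n) × Fin (m (widx h j))) ℂ :=
  fun p q => if (p.1 : ℕ) = (q.1 : ℕ) + 1 ∧ (p.2 : ℕ) = (q.2 : ℕ) then 1 else 0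

/-- ε''_n(A) := 2 r(A) sin(π/(2n+2)) + ‖C‖. -/
noncomputable def epsTau1 {N : ℕ} {m : Fin N → ℕ}
    (a : ∀ i j : Fin N, Matrix (Fin (m i)) (Fin (m j)) ℂ) (n : ℕ) : ℝ :=
  2 * rA a * Real.sin (Real.pi / (2 * (n : ℝ) + 2))
    + opNorm (blockMat m (remPart a))

/-- The τ₁-method inclusion set Γ^n_ε(A): the union over `k` of the closed
`(ε+ε''_n(A))`-pseudospectra of the rectangular matrices `B^+_{n,k}`. -/
lemma kwin {N n : ℕ} (h : n ≤ N) (k : Fin (N - n + 1)) : (k : ℕ) + n ≤ N := by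
  have := k.isLt; omega

noncomputable def GammaTau1 {N : ℕ} {m : Fin N → ℕ}
    (a : ∀ i j : Fin N, Matrix (Fin (m i)) (Fin (m j)) ℂ)
    (n : ℕ) (h : n ≤ N) (ε : ℝ) : Set ℂ :=
  ⋃ k : Fin (N - n + 1),
    {z : ℂ | sval (Bplus (triPart a) n k (kwin h k)
        - z • IplusMat m n k (kwin h k)) ≤ ε + epsTau1 a n}


/-- The starting (0-based) row/column index of block `i` in the block
decomposition with block sizes `m`. -/
def offset {N : ℕ} (m : Fin N → ℕ) (i : Fin N) : ℕ :=
  ∑ j ∈ Finset.univ.filter (fun j => j < i), m j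

lemma offset_add_lt {N M : ℕ} {m : Fin N → ℕ} (hsum : ∑ i, m i = M)
    (i : Fin N) (α : Fin (m i)) : offset m i + (α : ℕ) < M := by
  have h3 := Finset.sum_le_sum_of_subset
    (Finset.subset_univ (insert i (Finset.univ.filter (fun j => j < i)))) (f := m)
  rw [Finset.sum_insert (by simp)] at h3
  have := α.isLt
  unfold offset
  omega

/-- The block decomposition of an `M × M` matrix with block sizes `m`
(summing to `M`). -/
def blocksOf {M N : ℕ} (A : Matrix (Fin M) (Fin M) ℂ) (m : Fin N → ℕ)
    (hsum : ∑ i, m i = M) : ∀ i j : Fin N, Matrix (Fin (m i)) (Fin (m j)) ℂ :=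
  fun i j α β =>
    A ⟨offset m i + α, offset_add_lt hsum i α⟩ ⟨offset m j + β, offset_add_lt hsum j β⟩

/-- The order-`M` Toeplitz matrix with symbol coefficients `a`. -/
def ToepM (a : ℤ → ℂ) (M : ℕ) : Matrix (Fin M) (Fin M) ℂ :=
  fun i j => a ((i : ℤ) - (j : ℤ))

/-- The band-width `w_M` of the order-`M` Toeplitz matrix: the least `v` such
that all its entries vanish at distance more than `v` from the diagonal. -/
noncomputable def bandWidth (a : ℤ → ℂ) (M : ℕ) : ℕ :=
  sInf {v : ℕ | ∀ i j : Fin M, (v : ℤ) < |(i : ℤ) - (j : ℤ)| →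
    a ((i : ℤ) - (j : ℤ)) = 0}

/-- The closed ε-pseudospectrum of a bounded operator, with the convention
`‖(T−λI)^{−1}‖^{−1} := 0` when `T − λI` is not boundedly invertible
(`Ring.inverse` is `0` on non-units and `(0:ℝ)⁻¹ = 0`). -/
noncomputable def pspecOp {H : Type*} [NormedAddCommGroup H] [NormedSpace ℂ H]
    (ε : ℝ) (T : H →L[ℂ] H) : Set ℂ :=
  {z : ℂ | ‖Ring.inverse (T - z • (1 : H →L[ℂ] H))‖⁻¹ ≤ ε}

end SpecIncl

namespace SpecIncl

/-- `‖S⁻¹‖⁻¹`, with value `0` when `S` is not invertible. -/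
def lowerNorm {H : Type*} [NormedAddCommGroup H] [NormedSpace ℂ H] (S : H →L[ℂ] H) : ℝ :=
  ‖Ring.inverse S‖⁻¹

section Hilbert

variable {H : Type*} [NormedAddCommGroup H] [InnerProductSpace ℂ H]

lemma lowerNorm_nonneg (S : H →L[ℂ] H) : 0 ≤ lowerNorm S := by
  unfold lowerNorm; positivity

lemma isUnit_of_lowerNorm_pos {S : H →L[ℂ] H} (h : 0 < lowerNorm S) : IsUnit S := by
  by_contra hS
  simp [lowerNorm, Ring.inverse_non_unit _ hS] at h

lemma inverse_apply_self {S : H →L[ℂ] H} (h : IsUnit S) (v : H) : Ring.inverse S (S v) = v := by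
  simpa using congrArg (fun f : H →L[ℂ] H => f v) (Ring.inverse_mul_cancel S h)

lemma apply_inverse_self {S : H →L[ℂ] H} (h : IsUnit S) (v : H) : S (Ring.inverse S v) = v := by
  simpa using congrArg (fun f : H →L[ℂ] H => f v) (Ring.mul_inverse_cancel S h)

lemma lowerNorm_mul_norm_le (S : H →L[ℂ] H) (v : H) : lowerNorm S * ‖v‖ ≤ ‖S v‖ := by
  rcases (lowerNorm_nonneg S).eq_or_lt with h | h
  · rw [← h]; simp
  · have hv : ‖v‖ ≤ ‖Ring.inverse S‖ * ‖S v‖ := by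
      conv_lhs => rw [← inverse_apply_self (isUnit_of_lowerNorm_pos h) v]
      exact ContinuousLinearMap.le_opNorm _ _
    have hpos : 0 < ‖Ring.inverse S‖ := by simpa [lowerNorm] using h
    unfold lowerNorm
    rw [inv_mul_le_iff₀ hpos]
    exact hv

lemma exists_norm_lt_of_lowerNorm_lt_of_isUnit {S : H →L[ℂ] H} (hS : 0 < lowerNorm S) {t : ℝ}
    (ht : lowerNorm S < t) : ∃ y, ‖S y‖ < t * ‖y‖ := by
  have ht0 : 0 < t := hS.trans ht
  have hlt : t⁻¹ < ‖Ring.inverse S‖ := by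
    have hpos : 0 < ‖Ring.inverse S‖ := by simpa [lowerNorm] using hS
    exact (inv_lt_comm₀ hpos ht0).1 ht
  obtain ⟨x, hx, hx'⟩ := ContinuousLinearMap.exists_lt_apply_of_lt_opNorm _ hlt
  refine ⟨Ring.inverse S x, ?_⟩
  rw [apply_inverse_self (isUnit_of_lowerNorm_pos hS)]
  rw [inv_lt_iff_one_lt_mul₀' ht0] at hx'
  linarith

lemma exists_sq_re_mul_nonneg (p q : ℂ) {r : ℝ} (hr : 0 < r) :
    ∃ z : ℂ, ‖z‖ = r ∧ 0 ≤ (z ^ 2 * p).re ∧ 0 ≤ (z * q).re := by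
  obtain ⟨ζ, hζ, hζp⟩ : ∃ ζ : ℂ, ‖ζ‖ = r ^ 2 ∧ 0 ≤ (ζ * p).re := by
    rcases eq_or_ne p 0 with rfl | hp
    · exact ⟨(r ^ 2 : ℝ), by simp, by simp⟩
    · refine ⟨((r ^ 2 / ‖p‖ : ℝ) : ℂ) * starRingEnd ℂ p, ?_, ?_⟩
      · rw [norm_mul, RCLike.norm_conj, Complex.norm_real, Real.norm_of_nonneg (by positivity),
          div_mul_cancel₀ _ (norm_ne_zero_iff.2 hp)]
      · rw [mul_assoc, Complex.conj_mul', ← Complex.ofReal_pow, ← Complex.ofReal_mul,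
          Complex.ofReal_re]
        positivity
  obtain ⟨z, hz⟩ := IsAlgClosed.exists_pow_nat_eq ζ (n := 2) two_pos
  have hzr : ‖z‖ = r := by
    have : ‖z‖ ^ 2 = r ^ 2 := by rw [← norm_pow, hz, hζ]
    exact (pow_left_inj₀ (norm_nonneg z) hr.le two_ne_zero).1 this
  rcases le_total 0 (z * q).re with h | h
  · exact ⟨z, hzr, by rwa [hz], h⟩
  · exact ⟨-z, by rwa [norm_neg], by rwa [neg_sq, hz], by simpa using h⟩

/-- The resolvent norm of an operator on a Hilbert space is not locally maximal. -/
lemma exists_norm_lt_near {T : H →L[ℂ] H} {z₀ : ℂ}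
    (hs : 0 < lowerNorm (T - z₀ • (1 : H →L[ℂ] H))) {δ : ℝ} (hδ : 0 < δ) :
    ∃ z v, dist z₀ z ≤ δ ∧
      ‖(T - z • (1 : H →L[ℂ] H)) v‖ < lowerNorm (T - z₀ • (1 : H →L[ℂ] H)) * ‖v‖ := by
  set S := T - z₀ • (1 : H →L[ℂ] H) with hSdef
  set s := lowerNorm S with hsdef
  have hunit := isUnit_of_lowerNorm_pos hs
  set K := ‖S‖ + 1 with hK
  have hKpos : 0 < K := by positivity
  set r := min δ (s ^ 2 / (2 * K)) with hr
  have hrpos : 0 < r := lt_min hδ (by positivity)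
  have hr2 : r * (2 * K) ≤ s ^ 2 := by
    rw [← le_div_iff₀ (by positivity)]; exact min_le_right _ _
  set τ := s ^ 2 * r ^ 2 / (2 * K ^ 2) with hτ
  have hτpos : 0 < τ := by positivity
  have ht : s < Real.sqrt (s ^ 2 + τ) := by
    refine Real.lt_sqrt_of_sq_lt ?_
    linarith
  obtain ⟨y, hy⟩ := exists_norm_lt_of_lowerNorm_lt_of_isUnit hs ht
  set u := Ring.inverse S y with hu
  have hSu : S u = y := apply_inverse_self hunit y
  have hy0 : 0 < ‖y‖ := by
    by_contra! h
    have : ‖y‖ = 0 := le_antisymm h (norm_nonneg _)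
    rw [this, mul_zero] at hy
    exact absurd hy (not_lt.2 (norm_nonneg _))
  have hu1 : s * ‖u‖ ≤ ‖y‖ := by simpa [hSu] using lowerNorm_mul_norm_le S u
  have hu2 : ‖y‖ ≤ K * ‖u‖ := by
    rw [← hSu]
    refine (S.le_opNorm u).trans ?_
    gcongr
    linarith
  obtain ⟨z, hz, hz1, hz2⟩ := exists_sq_re_mul_nonneg (inner ℂ (S y) u) (inner ℂ y u) hrpos
  refine ⟨z₀ + z, y + z • u, ?_, ?_⟩
  · simp [dist_eq_norm, hz, hr]
  have hv : (T - (z₀ + z) • (1 : H →L[ℂ] H)) (y + z • u) = S y - z ^ 2 • u := by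
    have h1 : T - (z₀ + z) • (1 : H →L[ℂ] H) = S - z • (1 : H →L[ℂ] H) := by
      rw [hSdef, add_smul]; abel
    rw [h1]
    have h2 : (S - z • (1 : H →L[ℂ] H)) (y + z • u) = S (y + z • u) - z • (y + z • u) := rfl
    rw [h2, map_add, map_smul, hSu, smul_add, smul_smul, sq]
    abel
  rw [hv]
  have hsq : ‖S y - z ^ 2 • u‖ ^ 2 ≤ ‖S y‖ ^ 2 + r ^ 4 * ‖u‖ ^ 2 := by
    rw [norm_sub_sq (𝕜 := ℂ), inner_smul_right, norm_smul, norm_pow, hz]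
    have : (0 : ℝ) ≤ RCLike.re (z ^ 2 * inner ℂ (S y) u) := hz1
    nlinarith
  have hvsq : ‖y‖ ^ 2 + r ^ 2 * ‖u‖ ^ 2 ≤ ‖y + z • u‖ ^ 2 := by
    rw [norm_add_sq (𝕜 := ℂ), inner_smul_right, norm_smul, hz]
    have : (0 : ℝ) ≤ RCLike.re (z * inner ℂ y u) := hz2
    nlinarith
  have hysq : ‖S y‖ ^ 2 < (s ^ 2 + τ) * ‖y‖ ^ 2 := by
    have := pow_lt_pow_left₀ hy (norm_nonneg _) two_ne_zero
    rwa [mul_pow, Real.sq_sqrt (by positivity)] at this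
  have hA : τ * ‖y‖ ^ 2 ≤ s ^ 2 * r ^ 2 / 2 * ‖u‖ ^ 2 := by
    have : ‖y‖ ^ 2 ≤ K ^ 2 * ‖u‖ ^ 2 := by
      rw [← mul_pow]; exact pow_le_pow_left₀ hy0.le hu2 2
    calc τ * ‖y‖ ^ 2 ≤ τ * (K ^ 2 * ‖u‖ ^ 2) := by gcongr
      _ = s ^ 2 * r ^ 2 / 2 * ‖u‖ ^ 2 := by rw [hτ]; field_simp
  have hsK : s ≤ K := by
    have hu0 : 0 < ‖u‖ := by
      by_contra! h
      have : ‖u‖ = 0 := le_antisymm h (norm_nonneg _)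
      rw [this, mul_zero] at hu2
      linarith
    exact le_of_mul_le_mul_right (hu1.trans hu2) hu0
  have hB : r ^ 4 * ‖u‖ ^ 2 ≤ s ^ 2 * r ^ 2 / 2 * ‖u‖ ^ 2 := by
    have h1 : r * (2 * s) ≤ s ^ 2 := le_trans (by gcongr) hr2
    have h2 : 2 * r ≤ s := by nlinarith
    have : r ^ 2 ≤ s ^ 2 / 2 := by nlinarith
    have : r ^ 4 ≤ s ^ 2 * r ^ 2 / 2 := by nlinarith [sq_nonneg r]
    gcongr
  have hfin : ‖S y - z ^ 2 • u‖ ^ 2 < (s * ‖y + z • u‖) ^ 2 := by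
    have : s ^ 2 * (‖y‖ ^ 2 + r ^ 2 * ‖u‖ ^ 2) ≤ s ^ 2 * ‖y + z • u‖ ^ 2 := by gcongr
    rw [mul_pow]
    nlinarith
  exact lt_of_pow_lt_pow_left₀ 2 (by positivity) hfin

variable [CompleteSpace H]

lemma lowerNorm_adjoint (S : H →L[ℂ] H) :
    lowerNorm (ContinuousLinearMap.adjoint S) = lowerNorm S := by
  unfold lowerNorm
  rw [← ContinuousLinearMap.star_eq_adjoint, Ring.inverse_star, norm_star]

lemma le_lowerNorm [Nontrivial H] {S : H →L[ℂ] H} {c : ℝ} (hc : 0 < c)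
    (h₁ : ∀ v, c * ‖v‖ ≤ ‖S v‖) (h₂ : ∀ v, c * ‖v‖ ≤ ‖ContinuousLinearMap.adjoint S v‖) :
    c ≤ lowerNorm S := by
  have hanti : AntilipschitzWith (Real.toNNReal c⁻¹) S := by
    refine S.antilipschitz_of_bound fun v => ?_
    rw [Real.coe_toNNReal _ (by positivity), ← div_eq_inv_mul, le_div_iff₀ hc, mul_comm]
    exact h₁ v
  have hker : LinearMap.ker (ContinuousLinearMap.adjoint S).toLinearMap = ⊥ := by
    rw [LinearMap.ker_eq_bot']
    intro v hv
    have := h₂ v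
    have hv' : ContinuousLinearMap.adjoint S v = 0 := hv
    rw [hv', norm_zero] at this
    exact norm_le_zero_iff.1 (nonpos_of_mul_nonpos_right this hc)
  have hclosed : IsClosed (LinearMap.range S.toLinearMap : Set H) := by
    rw [LinearMap.coe_range]
    exact hanti.isClosed_range S.uniformContinuous
  have hrange : LinearMap.range S.toLinearMap = ⊤ := by
    have h := ContinuousLinearMap.orthogonal_range S
    have hker' : (LinearMap.range S.toLinearMap)ᗮ = ⊥ := by
      rw [← hker]; exact h
    have : CompleteSpace (LinearMap.range S.toLinearMap) := hclosed.completeSpace_coe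
    exact (Submodule.orthogonal_eq_bot_iff).1 hker'
  have hunit : IsUnit S := by
    rw [ContinuousLinearMap.isUnit_iff_bijective]
    exact ⟨hanti.injective, LinearMap.range_eq_top.1 hrange⟩
  have hle : ‖Ring.inverse S‖ ≤ c⁻¹ := by
    refine ContinuousLinearMap.opNorm_le_bound _ (by positivity) fun v => ?_
    rw [← div_eq_inv_mul, le_div_iff₀ hc, mul_comm]
    simpa [apply_inverse_self hunit] using h₁ (Ring.inverse S v)
  have hpos : 0 < ‖Ring.inverse S‖ := by
    rw [norm_pos_iff]
    intro h0
    obtain ⟨v, hv⟩ := exists_ne (0 : H)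
    apply hv
    rw [← inverse_apply_self hunit v, h0]
    simp
  unfold lowerNorm
  rwa [le_inv_comm₀ hc hpos]

lemma adjoint_sub_smul_one (T : H →L[ℂ] H) (z : ℂ) :
    ContinuousLinearMap.adjoint (T - z • (1 : H →L[ℂ] H)) =
      ContinuousLinearMap.adjoint T - (starRingEnd ℂ z) • (1 : H →L[ℂ] H) := by
  rw [← ContinuousLinearMap.star_eq_adjoint, ← ContinuousLinearMap.star_eq_adjoint]
  simp

lemma exists_norm_lt_of_lowerNorm_lt [Nontrivial H] {S : H →L[ℂ] H} {c : ℝ}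
    (h : lowerNorm S < c) :
    (∃ v, ‖S v‖ < c * ‖v‖) ∨ ∃ v, ‖ContinuousLinearMap.adjoint S v‖ < c * ‖v‖ := by
  by_contra! hcon
  exact absurd (le_lowerNorm ((lowerNorm_nonneg S).trans_lt h) hcon.1 hcon.2) (not_le.2 h)

lemma lowerNorm_le_add_dist [Nontrivial H] (T : H →L[ℂ] H) (z u : ℂ) :
    lowerNorm (T - z • (1 : H →L[ℂ] H)) ≤
      lowerNorm (T - u • (1 : H →L[ℂ] H)) + dist z u := by
  by_contra! hlt
  have key : ∀ (T' : H →L[ℂ] H) (p q : ℂ) (v : H), ‖p - q‖ = dist z u →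
      lowerNorm (T' - p • (1 : H →L[ℂ] H)) * ‖v‖ ≤
        ‖(T' - q • (1 : H →L[ℂ] H)) v‖ + dist z u * ‖v‖ := by
    intro T' p q v hpq
    refine (lowerNorm_mul_norm_le _ v).trans ?_
    have : (T' - p • (1 : H →L[ℂ] H)) v = (T' - q • (1 : H →L[ℂ] H)) v - (p - q) • v := by
      simp [sub_smul]
    rw [this]
    refine (norm_sub_le _ _).trans ?_
    rw [norm_smul, hpq]
  have hpos : 0 < lowerNorm (T - z • (1 : H →L[ℂ] H)) - dist z u := by
    have := lowerNorm_nonneg (T - u • (1 : H →L[ℂ] H))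
    linarith
  have := le_lowerNorm (S := T - u • (1 : H →L[ℂ] H)) hpos
    (fun v => by
      have := key T z u v (dist_eq_norm z u).symm
      linarith)
    (fun v => by
      have := key (ContinuousLinearMap.adjoint T) (starRingEnd ℂ z) (starRingEnd ℂ u) v
        (by rw [← map_sub, RCLike.norm_conj, dist_eq_norm])
      rw [← adjoint_sub_smul_one, ← adjoint_sub_smul_one, lowerNorm_adjoint] at this
      linarith)
  linarith

lemma norm_sub_norm_le_lowerNorm [Nontrivial H] (T : H →L[ℂ] H) (z : ℂ) :
    ‖z‖ - ‖T‖ ≤ lowerNorm (T - z • (1 : H →L[ℂ] H)) := by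
  rcases le_or_gt (‖z‖ - ‖T‖) 0 with h | h
  · exact h.trans (lowerNorm_nonneg _)
  have key : ∀ (T' : H →L[ℂ] H) (p : ℂ) (v : H), ‖p‖ = ‖z‖ → ‖T'‖ = ‖T‖ →
      (‖z‖ - ‖T‖) * ‖v‖ ≤ ‖(T' - p • (1 : H →L[ℂ] H)) v‖ := by
    intro T' p v hp hT'
    have h1 := T'.le_opNorm v
    have h2 : ‖p • v‖ ≤ ‖T' v‖ + ‖T' v - p • v‖ := by
      have := norm_sub_le (T' v) (T' v - p • v)
      simpa using this
    rw [norm_smul, hp] at h2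
    rw [hT'] at h1
    have : (T' - p • (1 : H →L[ℂ] H)) v = T' v - p • v := by simp
    rw [this]
    linarith
  refine le_lowerNorm h (fun v => key T z v rfl rfl) fun v => ?_
  rw [adjoint_sub_smul_one]
  exact key _ _ v (RCLike.norm_conj z) (by simp)

lemma isCompact_pspecOp [Nontrivial H] (T : H →L[ℂ] H) (ε : ℝ) : IsCompact (pspecOp ε T) := by
  have hlip : LipschitzWith 1 fun z : ℂ => lowerNorm (T - z • (1 : H →L[ℂ] H)) :=
    LipschitzWith.of_le_add fun z u => lowerNorm_le_add_dist T z u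
  refine (isCompact_closedBall (0 : ℂ) (‖T‖ + ε)).of_isClosed_subset
    (isClosed_le hlip.continuous continuous_const) fun z hz => ?_
  have h1 := norm_sub_norm_le_lowerNorm T z
  have h2 : lowerNorm (T - z • (1 : H →L[ℂ] H)) ≤ ε := hz
  rw [mem_closedBall_zero_iff]
  linarith

lemma exists_pspecOp_subset_thickening [Nontrivial H] (T : H →L[ℂ] H) (ε : ℝ) {δ : ℝ}
    (hδ : 0 < δ) :
    ∃ η > 0, ∀ z ∈ pspecOp (ε + η) T, ∃ u ∈ pspecOp ε T, dist z u ≤ δ := by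
  by_contra! hcon
  have hpos : ∀ k : ℕ, (0 : ℝ) < 1 / ((k : ℝ) + 1) := fun k => by positivity
  choose z hz hfar using fun k : ℕ => hcon _ (hpos k)
  have hmem : ∀ k, z k ∈ pspecOp (ε + 1) T := fun k => by
    have h1 : lowerNorm (T - z k • (1 : H →L[ℂ] H)) ≤ ε + 1 / ((k : ℝ) + 1) := hz k
    have h2 : 1 / ((k : ℝ) + 1) ≤ 1 := by
      rw [div_le_one (by positivity)]; linarith [(Nat.cast_nonneg k : (0 : ℝ) ≤ k)]
    change lowerNorm _ ≤ _
    linarith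
  obtain ⟨u, -, φ, hφ, hlim⟩ := (isCompact_pspecOp T (ε + 1)).tendsto_subseq hmem
  have hu : u ∈ pspecOp ε T := by
    have hlim1 : Filter.Tendsto (fun k => (ε + 1 / ((φ k : ℝ) + 1)) + dist u (z (φ k)))
        Filter.atTop (nhds ((ε + 0) + 0)) := by
      refine (tendsto_const_nhds.add
        (tendsto_one_div_add_atTop_nhds_zero_nat.comp hφ.tendsto_atTop)).add ?_
      have := (tendsto_iff_dist_tendsto_zero.1 hlim)
      simpa [dist_comm] using this
    have : lowerNorm (T - u • (1 : H →L[ℂ] H)) ≤ (ε + 0) + 0 := by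
      refine ge_of_tendsto' hlim1 fun k => ?_
      have h1 : lowerNorm (T - z (φ k) • (1 : H →L[ℂ] H)) ≤ ε + 1 / ((φ k : ℝ) + 1) := hz (φ k)
      have h2 := lowerNorm_le_add_dist T u (z (φ k))
      linarith
    rwa [add_zero, add_zero] at this
  have hev := (tendsto_iff_dist_tendsto_zero.1 hlim).eventually_lt_const hδ
  obtain ⟨k, hk⟩ := hev.exists
  exact absurd hk (not_lt.2 (hfar (φ k) u hu).le)

end Hilbert

/-- The sequence space `ℓ²(ℕ)`. -/
abbrev SeqSpace : Type := lp (fun _ : ℕ => ℂ) 2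

/-- `T` acts on `ℓ²(ℕ)` as the Toeplitz operator with symbol coefficients `a`. -/
def IsToeplitz (a : ℤ → ℂ) (T : SeqSpace →L[ℂ] SeqSpace) : Prop :=
  ∀ (x : SeqSpace) (i : ℕ), (T x : ℕ → ℂ) i = ∑' j : ℕ, a ((i : ℤ) - (j : ℤ)) * (x : ℕ → ℂ) j

/-- The vector of the first `M` terms of a sequence. -/
def vec (M : ℕ) (f : ℕ → ℂ) : EuclideanSpace ℂ (Fin M) := WithLp.toLp 2 fun i => f i

/-- The first `M` terms of a sequence, as an element of `ℓ²(ℕ)`. -/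
def cut (M : ℕ) (f : ℕ → ℂ) : SeqSpace := ∑ i ∈ Finset.range M, lp.single 2 i (f i)

/-- The action of the order-`M` Toeplitz matrix, shifted by `z`, on sequences. -/
def toepAct (a : ℤ → ℂ) (M : ℕ) (z : ℂ) (f : ℕ → ℂ) (i : ℕ) : ℂ :=
  ∑ j ∈ Finset.range M, a ((i : ℤ) - (j : ℤ)) * f j - z * f i

/-- The symbol coefficients of the adjoint Toeplitz operator. -/
def adjSymbol (a : ℤ → ℂ) (j : ℤ) : ℂ := starRingEnd ℂ (a (-j))

/-- Conjugation and reversal of the first `M` terms of a sequence. -/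
def conjFlip (M : ℕ) (f : ℕ → ℂ) (i : ℕ) : ℂ := starRingEnd ℂ (f (M - 1 - i))

lemma norm_vec_sq (M : ℕ) (f : ℕ → ℂ) : ‖vec M f‖ ^ 2 = ∑ i ∈ Finset.range M, ‖f i‖ ^ 2 := by
  rw [EuclideanSpace.norm_sq_eq, Finset.sum_range]
  rfl

lemma vec_congr {M : ℕ} {f g : ℕ → ℂ} (h : ∀ i < M, f i = g i) : vec M f = vec M g := by
  ext i
  exact h i i.isLt

lemma exists_vec_eq {M : ℕ} (x : EuclideanSpace ℂ (Fin M)) : ∃ f, vec M f = x := by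
  refine ⟨fun i => if h : i < M then x ⟨i, h⟩ else 0, ?_⟩
  ext i
  simp [vec]

lemma cut_apply (M : ℕ) (f : ℕ → ℂ) (i : ℕ) : (cut M f : ℕ → ℂ) i = if i < M then f i else 0 := by
  unfold cut
  rw [lp.coeFn_sum, Finset.sum_apply]
  simp [lp.single_apply, Pi.single_apply]

lemma norm_cut (M : ℕ) (f : ℕ → ℂ) : ‖cut M f‖ = ‖vec M f‖ := by
  have h := lp.norm_sum_single (E := fun _ : ℕ => ℂ) (p := 2) (by simp) f (Finset.range M)
  simp only [ENNReal.toReal_ofNat, Real.rpow_ofNat] at h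
  rw [← norm_vec_sq] at h
  exact (pow_left_inj₀ (norm_nonneg _) (norm_nonneg _) two_ne_zero).1 h

lemma tendsto_cut (v : SeqSpace) :
    Filter.Tendsto (fun M => cut M (v : ℕ → ℂ)) Filter.atTop (nhds v) :=
  (lp.hasSum_single (E := fun _ : ℕ => ℂ) (p := 2) (by simp) v).tendsto_sum_nat

lemma norm_vec_coe_le (M : ℕ) (v : SeqSpace) : ‖vec M (v : ℕ → ℂ)‖ ≤ ‖v‖ := by
  have h := lp.sum_rpow_le_norm_rpow (E := fun _ : ℕ => ℂ) (p := 2) (by simp) v (Finset.range M)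
  simp only [ENNReal.toReal_ofNat, Real.rpow_ofNat] at h
  rw [← norm_vec_sq] at h
  exact (pow_le_pow_iff_left₀ (norm_nonneg _) (norm_nonneg _) two_ne_zero).1 h

lemma norm_conjFlip (M : ℕ) (f : ℕ → ℂ) : ‖vec M (conjFlip M f)‖ = ‖vec M f‖ := by
  rw [← pow_left_inj₀ (norm_nonneg _) (norm_nonneg _) two_ne_zero, norm_vec_sq, norm_vec_sq,
    ← Finset.sum_range_reflect (fun i => ‖f i‖ ^ 2)]
  simp [conjFlip]

lemma toepAct_adjSymbol (a : ℤ → ℂ) (z : ℂ) (f : ℕ → ℂ) {M i : ℕ} (hi : i < M) :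
    toepAct (adjSymbol a) M (starRingEnd ℂ z) (conjFlip M f) i =
      conjFlip M (toepAct a M z f) i := by
  unfold toepAct conjFlip adjSymbol
  rw [map_sub, map_sum, map_mul]
  congr 1
  rw [← Finset.sum_range_reflect]
  refine Finset.sum_congr rfl fun j hj => ?_
  rw [Finset.mem_range] at hj
  rw [map_mul]
  congr 3
  · omega
  · omega

lemma toEuclideanLin_toepM (a : ℤ → ℂ) (M : ℕ) (z : ℂ) (f : ℕ → ℂ) :
    Matrix.toEuclideanLin (ToepM a M - z • (1 : Matrix (Fin M) (Fin M) ℂ)) (vec M f) =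
      vec M (toepAct a M z f) := by
  ext i
  simp only [Matrix.toLpLin_apply, vec, toepAct, Matrix.sub_mulVec, Matrix.smul_mulVec,
    Matrix.one_mulVec, Finset.sum_range]
  rfl

lemma sval_le {ι κ : Type*} [Fintype ι] [Fintype κ] [DecidableEq κ] {F : Matrix ι κ ℂ} {s : ℝ}
    {x : EuclideanSpace ℂ κ} (hx : x ≠ 0) (h : ‖Matrix.toEuclideanLin F x‖ ≤ s * ‖x‖) :
    sval F ≤ s := by
  have hpos : 0 < ‖x‖ := norm_pos_iff.2 hx
  have hmem : ‖Matrix.toEuclideanLin F (((‖x‖⁻¹ : ℝ) : ℂ) • x)‖ ≤ s := by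
    rw [map_smul, norm_smul, Complex.norm_real, Real.norm_of_nonneg (by positivity),
      inv_mul_le_iff₀ hpos, mul_comm]
    exact h
  refine le_trans (csInf_le ⟨0, ?_⟩ ⟨((‖x‖⁻¹ : ℝ) : ℂ) • x, ?_, rfl⟩) hmem
  · rintro y ⟨v, -, rfl⟩
    exact norm_nonneg _
  · rw [norm_smul, Complex.norm_real, Real.norm_of_nonneg (by positivity),
      inv_mul_cancel₀ hpos.ne']

lemma le_sval {ι κ : Type*} [Fintype ι] [Fintype κ] [DecidableEq κ] [Nonempty κ]
    {F : Matrix ι κ ℂ} {s : ℝ} (h : ∀ x, s * ‖x‖ ≤ ‖Matrix.toEuclideanLin F x‖) :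
    s ≤ sval F := by
  refine le_csInf ?_ ?_
  · obtain ⟨k⟩ := ‹Nonempty κ›
    exact ⟨_, EuclideanSpace.single k 1, by simp, rfl⟩
  · rintro y ⟨x, hx, rfl⟩
    simpa [hx] using h x

lemma sval_adjSymbol_le (a : ℤ → ℂ) {M : ℕ} (hM : 0 < M) (z : ℂ) :
    sval (ToepM a M - z • (1 : Matrix (Fin M) (Fin M) ℂ)) ≤
      sval (ToepM (adjSymbol a) M - (starRingEnd ℂ z) • (1 : Matrix (Fin M) (Fin M) ℂ)) := by
  have : Nonempty (Fin M) := ⟨⟨0, hM⟩⟩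
  refine le_sval fun x => ?_
  obtain ⟨f, rfl⟩ := exists_vec_eq x
  rcases eq_or_ne (vec M f) 0 with h0 | h0
  · rw [h0]; simp
  rw [← le_div_iff₀ (norm_pos_iff.2 h0)]
  refine sval_le (x := vec M (conjFlip M f)) ?_ ?_
  · rw [← norm_ne_zero_iff, norm_conjFlip]
    exact norm_ne_zero_iff.2 h0
  · rw [norm_conjFlip, div_mul_cancel₀ _ (norm_ne_zero_iff.2 h0), toEuclideanLin_toepM,
      toEuclideanLin_toepM, ← norm_conjFlip M (toepAct _ _ _ f)]
    refine le_of_eq (congrArg _ (vec_congr fun i hi => ?_))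
    rw [← toepAct_adjSymbol _ _ _ hi]
    simp only [Complex.conj_conj]
    congr 1
    funext j
    simp [adjSymbol]

lemma IsToeplitz.adjoint {a : ℤ → ℂ} {T : SeqSpace →L[ℂ] SeqSpace} (hT : IsToeplitz a T) :
    IsToeplitz (adjSymbol a) (ContinuousLinearMap.adjoint T) := by
  intro x i
  have h1 : inner ℂ (lp.single 2 i (1 : ℂ) : SeqSpace) (ContinuousLinearMap.adjoint T x) =
      (ContinuousLinearMap.adjoint T x : ℕ → ℂ) i := by
    rw [lp.inner_single_left]; simp
  rw [← h1, ContinuousLinearMap.adjoint_inner_right, lp.inner_eq_tsum]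
  refine tsum_congr fun j => ?_
  have h2 : (T (lp.single 2 i (1 : ℂ)) : ℕ → ℂ) j = a ((j : ℤ) - i) := by
    rw [hT, tsum_eq_single i]
    · simp
    · intro k hk
      simp [hk]
  rw [h2, RCLike.inner_apply, mul_comm, adjSymbol, neg_sub]

lemma IsToeplitz.apply_cut {a : ℤ → ℂ} {T : SeqSpace →L[ℂ] SeqSpace} (hT : IsToeplitz a T)
    (M : ℕ) (z : ℂ) (f : ℕ → ℂ) (i : ℕ) :
    ((T - z • (1 : SeqSpace →L[ℂ] SeqSpace)) (cut M f) : ℕ → ℂ) i =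
      ∑ j ∈ Finset.range M, a ((i : ℤ) - (j : ℤ)) * f j - z * if i < M then f i else 0 := by
  have h : ((T - z • (1 : SeqSpace →L[ℂ] SeqSpace)) (cut M f) : ℕ → ℂ) i =
      (T (cut M f) : ℕ → ℂ) i - z * (cut M f : ℕ → ℂ) i := rfl
  rw [h, hT, cut_apply, tsum_eq_sum (s := Finset.range M)]
  · congr 1
    refine Finset.sum_congr rfl fun j hj => ?_
    rw [cut_apply, if_pos (Finset.mem_range.1 hj)]
  · intro j hj
    rw [cut_apply, if_neg (by simpa using hj), mul_zero]

lemma IsToeplitz.norm_toepAct_le {a : ℤ → ℂ} {T : SeqSpace →L[ℂ] SeqSpace}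
    (hT : IsToeplitz a T) (M : ℕ) (z : ℂ) (f : ℕ → ℂ) :
    ‖vec M (toepAct a M z f)‖ ≤ ‖(T - z • (1 : SeqSpace →L[ℂ] SeqSpace)) (cut M f)‖ := by
  rw [vec_congr (g := ((T - z • (1 : SeqSpace →L[ℂ] SeqSpace)) (cut M f) : ℕ → ℂ))]
  · exact norm_vec_coe_le _ _
  · intro i hi
    rw [hT.apply_cut, if_pos hi, toepAct]

/-- If `v` witnesses that `T - z` is not bounded below by `s`, then so do its truncations. -/
lemma IsToeplitz.eventually_sval_le {a : ℤ → ℂ} {T : SeqSpace →L[ℂ] SeqSpace}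
    (hT : IsToeplitz a T) {z : ℂ} {s : ℝ} {v : SeqSpace}
    (hv : ‖(T - z • (1 : SeqSpace →L[ℂ] SeqSpace)) v‖ < s * ‖v‖) :
    ∀ᶠ M in Filter.atTop, sval (ToepM a M - z • (1 : Matrix (Fin M) (Fin M) ℂ)) ≤ s := by
  have h1 := (((T - z • (1 : SeqSpace →L[ℂ] SeqSpace)).continuous.tendsto v).comp
    (tendsto_cut v)).norm
  have h2 := ((tendsto_cut v).norm).const_mul s
  filter_upwards [h1.eventually_lt h2 hv] with M hM
  have hlt : ‖vec M (toepAct a M z v)‖ < s * ‖vec M (v : ℕ → ℂ)‖ := by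
    rw [← norm_cut M (v : ℕ → ℂ)]
    exact (hT.norm_toepAct_le M z v).trans_lt hM
  refine sval_le (x := vec M (v : ℕ → ℂ)) ?_ ?_
  · intro h0
    rw [h0, norm_zero, mul_zero] at hlt
    exact absurd hlt (not_lt.2 (norm_nonneg _))
  · rw [toEuclideanLin_toepM]
    exact hlt.le

lemma card_band_le (s : Finset ℕ) (i w : ℕ) :
    (s.filter fun j => i ≤ j + w ∧ j ≤ i + w).card ≤ 2 * w + 1 := by
  have hsub : (s.filter fun j => i ≤ j + w ∧ j ≤ i + w) ⊆ Finset.Icc (i - w) (i + w) := by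
    intro j hj
    rw [Finset.mem_filter] at hj
    rw [Finset.mem_Icc]
    omega
  refine (Finset.card_le_card hsub).trans ?_
  rw [Nat.card_Icc]
  omega

/-- A Schur-type bound for banded kernels with bounded entries. -/
lemma sum_norm_sq_band_le {k : ℕ → ℕ → ℂ} {w M : ℕ} {B : ℝ} (hB : ∀ i j, ‖k i j‖ ≤ B)
    (hk : ∀ i j, ¬(i ≤ j + w ∧ j ≤ i + w) → k i j = 0) (f : ℕ → ℂ) (s : Finset ℕ) :
    ∑ i ∈ s, ‖∑ j ∈ Finset.range M, k i j * f j‖ ^ 2 ≤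
      ((2 * w + 1 : ℝ) * B * ‖vec M f‖) ^ 2 := by
  have hrow : ∀ i, ‖∑ j ∈ Finset.range M, k i j * f j‖ ^ 2 ≤
      (2 * w + 1 : ℝ) * B ^ 2 *
        ∑ j ∈ (Finset.range M).filter (fun j => i ≤ j + w ∧ j ≤ i + w), ‖f j‖ ^ 2 := by
    intro i
    have h1 : ∑ j ∈ Finset.range M, k i j * f j =
        ∑ j ∈ (Finset.range M).filter (fun j => i ≤ j + w ∧ j ≤ i + w), k i j * f j := by
      refine (Finset.sum_filter_of_ne fun j _ hj => ?_).symm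
      by_contra h
      rw [hk i j h, zero_mul] at hj
      exact hj rfl
    rw [h1]
    calc _ ≤ (∑ j ∈ (Finset.range M).filter (fun j => i ≤ j + w ∧ j ≤ i + w), B * ‖f j‖) ^ 2 := by
          gcongr
          refine norm_sum_le_of_le _ fun j _ => ?_
          rw [norm_mul]
          gcongr
          exact hB i j
      _ ≤ ((Finset.range M).filter (fun j => i ≤ j + w ∧ j ≤ i + w)).card *
            ∑ j ∈ (Finset.range M).filter (fun j => i ≤ j + w ∧ j ≤ i + w), (B * ‖f j‖) ^ 2 :=
          sq_sum_le_card_mul_sum_sq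
      _ ≤ (2 * w + 1 : ℝ) *
            ∑ j ∈ (Finset.range M).filter (fun j => i ≤ j + w ∧ j ≤ i + w), (B * ‖f j‖) ^ 2 := by
          gcongr
          exact_mod_cast card_band_le _ i w
      _ = _ := by
          simp only [mul_pow]
          rw [← Finset.mul_sum, mul_assoc]
  refine (Finset.sum_le_sum fun i _ => hrow i).trans ?_
  rw [← Finset.mul_sum, mul_pow, mul_pow, sq (2 * (w : ℝ) + 1), norm_vec_sq]
  have hswap : ∑ i ∈ s, ∑ j ∈ (Finset.range M).filter (fun j => i ≤ j + w ∧ j ≤ i + w),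
      ‖f j‖ ^ 2 ≤ (2 * w + 1 : ℝ) * ∑ j ∈ Finset.range M, ‖f j‖ ^ 2 := by
    simp only [Finset.sum_filter]
    rw [Finset.sum_comm, Finset.mul_sum]
    refine Finset.sum_le_sum fun j _ => ?_
    rw [← Finset.sum_filter, Finset.sum_const, nsmul_eq_mul]
    gcongr
    have := card_band_le s j w
    simp only [and_comm (a := j ≤ _ + w)] at this
    exact_mod_cast this
  calc _ ≤ (2 * w + 1 : ℝ) * B ^ 2 * ((2 * w + 1 : ℝ) * ∑ j ∈ Finset.range M, ‖f j‖ ^ 2) := by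
        gcongr
    _ = _ := by ring

lemma exists_symbol_bound {a : ℤ → ℂ} {w : ℕ} (hband : ∀ j : ℤ, (w : ℤ) < |j| → a j = 0) :
    ∃ C, 0 ≤ C ∧ ∀ j, ‖a j‖ ≤ C := by
  refine ⟨∑ j ∈ Finset.Icc (-(w : ℤ)) w, ‖a j‖, by positivity, fun j => ?_⟩
  by_cases hj : (w : ℤ) < |j|
  · rw [hband j hj, norm_zero]; positivity
  · refine Finset.single_le_sum (f := fun j => ‖a j‖) (fun _ _ => norm_nonneg _) ?_
    rw [Finset.mem_Icc]
    exact abs_le.1 (not_lt.1 hj)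

/-- Multiplication by a slowly varying sequence almost commutes with a banded Toeplitz operator. -/
lemma IsToeplitz.norm_commutator_le {a : ℤ → ℂ} {T : SeqSpace →L[ℂ] SeqSpace}
    (hT : IsToeplitz a T) {w : ℕ} (hband : ∀ j : ℤ, (w : ℤ) < |j| → a j = 0) {C : ℝ}
    (hC : ∀ j, ‖a j‖ ≤ C) {φ : ℕ → ℝ} {l : ℝ} (hl : 0 ≤ l)
    (hφ : ∀ i j : ℕ, |φ i - φ j| ≤ l * |(i : ℝ) - j|) {M : ℕ} (hφM : ∀ i, M ≤ i → φ i = 0)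
    (z : ℂ) (f : ℕ → ℂ) :
    ‖(T - z • (1 : SeqSpace →L[ℂ] SeqSpace)) (cut M fun i => φ i * f i) -
      cut M (fun i => φ i * toepAct a M z f i)‖ ≤ (2 * w + 1 : ℝ) * (C * (l * w)) * ‖vec M f‖ := by
  have hC0 : 0 ≤ C := (norm_nonneg _).trans (hC 0)
  refine lp.norm_le_of_forall_sum_le (by simp) (by positivity) fun s => ?_
  simp only [ENNReal.toReal_ofNat, Real.rpow_ofNat]
  have hcoord : ∀ i, ((T - z • (1 : SeqSpace →L[ℂ] SeqSpace)) (cut M fun i => φ i * f i) -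
      cut M (fun i => φ i * toepAct a M z f i) : SeqSpace) i =
      ∑ j ∈ Finset.range M, (a ((i : ℤ) - j) * ((φ j : ℂ) - φ i)) * f j := by
    intro i
    rw [lp.coeFn_sub, Pi.sub_apply, hT.apply_cut, cut_apply]
    have hexp : ∑ j ∈ Finset.range M, (a ((i : ℤ) - j) * ((φ j : ℂ) - φ i)) * f j =
        ∑ j ∈ Finset.range M, a ((i : ℤ) - j) * (φ j * f j) -
          φ i * ∑ j ∈ Finset.range M, a ((i : ℤ) - j) * f j := by
      rw [Finset.mul_sum, ← Finset.sum_sub_distrib]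
      exact Finset.sum_congr rfl fun j _ => by ring
    rw [hexp]
    split_ifs with hi
    · rw [toepAct]; ring
    · rw [hφM i (not_lt.1 hi)]; simp
  simp only [hcoord]
  have hzero : ∀ i j : ℕ, ¬(i ≤ j + w ∧ j ≤ i + w) → a ((i : ℤ) - j) = 0 := fun i j h => by
    refine hband _ ?_
    rw [lt_abs]
    omega
  refine sum_norm_sq_band_le (w := w) (fun i j => ?_) (fun i j h => ?_) f s
  · by_cases h : i ≤ j + w ∧ j ≤ i + w
    · rw [norm_mul]
      refine mul_le_mul (hC _) ?_ (norm_nonneg _) hC0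
      rw [← Complex.ofReal_sub, Complex.norm_real, Real.norm_eq_abs]
      refine (hφ j i).trans (mul_le_mul_of_nonneg_left ?_ hl)
      rw [abs_le]
      have h1 : (i : ℝ) ≤ j + w := by exact_mod_cast h.1
      have h2 : (j : ℝ) ≤ i + w := by exact_mod_cast h.2
      constructor <;> linarith
    · rw [hzero i j h, zero_mul, norm_zero]; positivity
  · rw [hzero i j h, zero_mul]

/-- A cosine cut-off vanishing from the index `M` on. -/
def cosCut (M i : ℕ) : ℝ := Real.cos (π / 2 * (min ((i : ℝ) + 1) (M + 1) / (M + 1)))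

lemma cosCut_eq_zero {M i : ℕ} (h : M ≤ i) : cosCut M i = 0 := by
  have h' : (M : ℝ) ≤ i := by exact_mod_cast h
  rw [cosCut, min_eq_right (by linarith), div_self (by positivity), mul_one, Real.cos_pi_div_two]

lemma abs_cosCut_sub_le (M i j : ℕ) :
    |cosCut M i - cosCut M j| ≤ π / 2 / (M + 1) * |(i : ℝ) - j| := by
  refine (Real.abs_cos_sub_cos_le _ _).trans ?_
  have hrw : π / 2 * (min ((i : ℝ) + 1) (M + 1) / (M + 1)) -
      π / 2 * (min ((j : ℝ) + 1) (M + 1) / (M + 1)) =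
      π / 2 / (M + 1) * (min ((i : ℝ) + 1) (M + 1) - min ((j : ℝ) + 1) (M + 1)) := by ring
  rw [hrw, abs_mul, abs_of_nonneg (by positivity)]
  refine mul_le_mul_of_nonneg_left ?_ (by positivity)
  have := abs_min_sub_min_le_max ((i : ℝ) + 1) (M + 1) ((j : ℝ) + 1) (M + 1)
  simpa using this

lemma cosCut_sq_add {M i : ℕ} (h : i < M) : cosCut M i ^ 2 + cosCut M (M - 1 - i) ^ 2 = 1 := by
  have hi : (i : ℝ) + 1 ≤ M := by exact_mod_cast h
  have hcast : ((M - 1 - i : ℕ) : ℝ) = M - 1 - i := by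
    rw [Nat.cast_sub (by omega), Nat.cast_sub (by omega)]; simp
  have hi0 : (0 : ℝ) ≤ i := i.cast_nonneg
  have hang : π / 2 * (((M : ℝ) - 1 - i + 1) / (M + 1)) =
      π / 2 - π / 2 * (((i : ℝ) + 1) / (M + 1)) := by
    field_simp
    ring
  rw [cosCut, cosCut, hcast, min_eq_left (by linarith), min_eq_left (by linarith), hang,
    Real.cos_pi_div_two_sub]
  exact Real.cos_sq_add_sin_sq _

lemma norm_cosCut_sq_add (M : ℕ) (f : ℕ → ℂ) :
    ‖vec M fun i => cosCut M i * f i‖ ^ 2 + ‖vec M fun i => cosCut M i * conjFlip M f i‖ ^ 2 =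
      ‖vec M f‖ ^ 2 := by
  rw [norm_vec_sq, norm_vec_sq, norm_vec_sq,
    ← Finset.sum_range_reflect (fun i => ‖(cosCut M i : ℂ) * conjFlip M f i‖ ^ 2),
    ← Finset.sum_add_distrib]
  refine Finset.sum_congr rfl fun i hi => ?_
  rw [Finset.mem_range] at hi
  have hflip : M - 1 - (M - 1 - i) = i := by omega
  rw [norm_mul, norm_mul, mul_pow, mul_pow, conjFlip, hflip, RCLike.norm_conj, ← add_mul,
    Complex.norm_real, Complex.norm_real, Real.norm_eq_abs, Real.norm_eq_abs, sq_abs, sq_abs,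
    cosCut_sq_add hi, one_mul]

/-- The smallest singular values of the finite sections are asymptotically bounded below by
`‖(T - z)⁻¹‖⁻¹`, uniformly in `z`. -/
lemma IsToeplitz.exists_lowerNorm_le_sval_add {a : ℤ → ℂ} {T : SeqSpace →L[ℂ] SeqSpace}
    (hT : IsToeplitz a T) {w : ℕ} (hband : ∀ j : ℤ, (w : ℤ) < |j| → a j = 0) :
    ∃ D, 0 ≤ D ∧ ∀ M : ℕ, 0 < M → ∀ z : ℂ,
      lowerNorm (T - z • (1 : SeqSpace →L[ℂ] SeqSpace)) ≤
        sval (ToepM a M - z • (1 : Matrix (Fin M) (Fin M) ℂ)) + D / (M + 1) := by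
  obtain ⟨C, hC0, hC⟩ := exists_symbol_bound hband
  have hband' : ∀ j : ℤ, (w : ℤ) < |j| → adjSymbol a j = 0 := fun j hj => by
    rw [adjSymbol, hband _ (by rwa [abs_neg]), map_zero]
  have hC' : ∀ j, ‖adjSymbol a j‖ ≤ C := fun j => by
    rw [adjSymbol, RCLike.norm_conj]; exact hC _
  refine ⟨2 * ((2 * w + 1 : ℝ) * (C * (π / 2 * w))), by positivity, fun M hM z => ?_⟩
  have : Nonempty (Fin M) := ⟨⟨0, hM⟩⟩
  set c := lowerNorm (T - z • (1 : SeqSpace →L[ℂ] SeqSpace)) with hc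
  have hc0 : 0 ≤ c := lowerNorm_nonneg _
  set d := (2 * w + 1 : ℝ) * (C * (π / 2 / (M + 1) * w)) with hd
  have hd0 : 0 ≤ d := by positivity
  have hdD : 2 * ((2 * w + 1 : ℝ) * (C * (π / 2 * w))) / (M + 1) = 2 * d := by rw [hd]; ring
  rw [hdD, ← sub_le_iff_le_add]
  refine le_sval fun x => ?_
  obtain ⟨f, rfl⟩ := exists_vec_eq x
  rw [toEuclideanLin_toepM]
  have key : ∀ {b : ℤ → ℂ} {S : SeqSpace →L[ℂ] SeqSpace} {u : ℂ}, IsToeplitz b S →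
      (∀ j : ℤ, (w : ℤ) < |j| → b j = 0) → (∀ j, ‖b j‖ ≤ C) →
      lowerNorm (S - u • (1 : SeqSpace →L[ℂ] SeqSpace)) = c → ∀ g : ℕ → ℂ,
      c * ‖vec M fun i => cosCut M i * g i‖ ≤
        ‖vec M fun i => cosCut M i * toepAct b M u g i‖ + d * ‖vec M g‖ := by
    intro b S u hS hb hbC hlow g
    have h1 := lowerNorm_mul_norm_le (S - u • (1 : SeqSpace →L[ℂ] SeqSpace))
      (cut M fun i => cosCut M i * g i)
    have h2 := hS.norm_commutator_le hb hbC (l := π / 2 / (M + 1)) (by positivity)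
      (abs_cosCut_sub_le M) (fun i => cosCut_eq_zero) u g
    have h3 := norm_le_norm_add_norm_sub' ((S - u • (1 : SeqSpace →L[ℂ] SeqSpace))
      (cut M fun i => cosCut M i * g i)) (cut M (fun i => cosCut M i * toepAct b M u g i))
    rw [hlow, norm_cut] at h1
    rw [norm_cut] at h3
    linarith
  have k1 := key hT hband hC rfl f
  have k2 := key hT.adjoint hband' hC' (u := starRingEnd ℂ z)
    (by rw [← adjoint_sub_smul_one, lowerNorm_adjoint]) (conjFlip M f)
  have hact : (vec M fun i => cosCut M i *
      toepAct (adjSymbol a) M (starRingEnd ℂ z) (conjFlip M f) i) =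
      vec M fun i => cosCut M i * conjFlip M (toepAct a M z f) i :=
    vec_congr fun i hi => by rw [toepAct_adjSymbol a z f hi]
  rw [hact, norm_conjFlip] at k2
  have e1 := norm_cosCut_sq_add M f
  have e2 := norm_cosCut_sq_add M (toepAct a M z f)
  have p₁0 : 0 ≤ ‖vec M fun i => cosCut M i * f i‖ := norm_nonneg _
  have p₂0 : 0 ≤ ‖vec M fun i => cosCut M i * conjFlip M f i‖ := norm_nonneg _
  generalize ‖vec M fun i => cosCut M i * f i‖ = p₁ at *
  generalize ‖vec M fun i => cosCut M i * conjFlip M f i‖ = p₂ at *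
  have q₁0 : 0 ≤ ‖vec M fun i => cosCut M i * toepAct a M z f i‖ := norm_nonneg _
  have q₂0 : 0 ≤ ‖vec M fun i => cosCut M i * conjFlip M (toepAct a M z f) i‖ := norm_nonneg _
  generalize ‖vec M fun i => cosCut M i * toepAct a M z f i‖ = q₁ at *
  generalize ‖vec M fun i => cosCut M i * conjFlip M (toepAct a M z f) i‖ = q₂ at *
  have hX : 0 ≤ ‖vec M f‖ := norm_nonneg _
  have hY : 0 ≤ ‖vec M (toepAct a M z f)‖ := norm_nonneg _
  generalize ‖vec M f‖ = X at *
  generalize ‖vec M (toepAct a M z f)‖ = Y at *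
  have hq₁ : q₁ ≤ Y := abs_le_of_sq_le_sq' (by nlinarith) hY |>.2
  have hq₂ : q₂ ≤ Y := abs_le_of_sq_le_sq' (by nlinarith) hY |>.2
  have s₁ := pow_le_pow_left₀ (by positivity) k1 2
  have s₂ := pow_le_pow_left₀ (by positivity) k2 2
  have hdX : 0 ≤ d * X := by positivity
  have hsq : (c * X) ^ 2 ≤ (Y + 2 * (d * X)) ^ 2 := by
    have h₁ : (c * X) ^ 2 = (c * p₁) ^ 2 + (c * p₂) ^ 2 := by rw [mul_pow, ← e1]; ring
    have h₂ : d * X * q₁ ≤ d * X * Y := by gcongr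
    have h₃ : d * X * q₂ ≤ d * X * Y := by gcongr
    nlinarith [sq_nonneg (d * X)]
  have := (abs_le_of_sq_le_sq' hsq (by positivity)).2
  linarith

instance : Nontrivial SeqSpace :=
  ⟨lp.single 2 0 (1 : ℂ), 0, fun h => by
    have := congrArg (fun x : SeqSpace => (x : ℕ → ℂ) 0) h
    simp at this⟩

lemma IsToeplitz.eventually_sval_le_of_lowerNorm_lt {a : ℤ → ℂ} {T : SeqSpace →L[ℂ] SeqSpace}
    (hT : IsToeplitz a T) {z : ℂ} {s : ℝ}
    (hs : lowerNorm (T - z • (1 : SeqSpace →L[ℂ] SeqSpace)) < s) :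
    ∀ᶠ M in Filter.atTop, sval (ToepM a M - z • (1 : Matrix (Fin M) (Fin M) ℂ)) ≤ s := by
  rcases exists_norm_lt_of_lowerNorm_lt hs with ⟨v, hv⟩ | ⟨v, hv⟩
  · exact hT.eventually_sval_le hv
  · rw [adjoint_sub_smul_one] at hv
    filter_upwards [hT.adjoint.eventually_sval_le hv, Filter.eventually_gt_atTop 0] with M hM hM0
    exact (sval_adjSymbol_le a hM0 z).trans hM

lemma exists_mem_pspec_zero_of_isHermitian {ι : Type*} [Fintype ι] [DecidableEq ι] [Nonempty ι]
    {A : Matrix ι ι ℂ} (hA : A.IsHermitian) {z : ℂ} {s : ℝ} (hs0 : 0 ≤ s)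
    (hs : sval (A - z • (1 : Matrix ι ι ℂ)) < s) : ∃ u ∈ pspec 0 A, dist z u ≤ s := by
  by_contra! hcon
  have hfar : ∀ i, s ≤ ‖(hA.eigenvalues i : ℂ) - z‖ := fun i => by
    rw [← dist_eq_norm, dist_comm]
    refine (hcon _ ?_).le
    refine sval_le (x := hA.eigenvectorBasis i) (hA.eigenvectorBasis.orthonormal.ne_zero i) ?_
    have h : Matrix.toEuclideanLin (A - (hA.eigenvalues i : ℂ) • (1 : Matrix ι ι ℂ))
        (hA.eigenvectorBasis i) = 0 := by
      ext k
      have := congrFun (hA.mulVec_eigenvectorBasis i) k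
      simp [Matrix.smul_mulVec, this]
    rw [h, norm_zero, zero_mul]
  refine absurd hs (not_lt.2 (le_sval fun x => ?_))
  have hinner : ∀ i, inner ℂ (hA.eigenvectorBasis i)
      (Matrix.toEuclideanLin (A - z • (1 : Matrix ι ι ℂ)) x) =
      ((hA.eigenvalues i : ℂ) - z) * inner ℂ (hA.eigenvectorBasis i) x := by
    intro i
    have hsub : Matrix.toEuclideanLin (A - z • (1 : Matrix ι ι ℂ)) x =
        Matrix.toEuclideanLin A x - z • x := by
      ext k
      simp
    have heig : Matrix.toEuclideanLin A (hA.eigenvectorBasis i) =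
        (hA.eigenvalues i : ℂ) • hA.eigenvectorBasis i := by
      ext k
      have := congrFun (hA.mulVec_eigenvectorBasis i) k
      simpa using this
    have hsymm := (Matrix.isSymmetric_toEuclideanLin_iff.2 hA) (hA.eigenvectorBasis i) x
    rw [hsub, inner_sub_right, inner_smul_right, ← hsymm, heig, inner_smul_left,
      Complex.conj_ofReal, sub_mul]
  refine (pow_le_pow_iff_left₀ (by positivity) (norm_nonneg _) two_ne_zero).1 ?_
  rw [mul_pow, ← hA.eigenvectorBasis.sum_sq_norm_inner_right x,
    ← hA.eigenvectorBasis.sum_sq_norm_inner_right (Matrix.toEuclideanLin _ x), Finset.mul_sum]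
  refine Finset.sum_le_sum fun i _ => ?_
  rw [hinner, norm_mul, mul_pow]
  gcongr
  exact hfar i

lemma IsToeplitz.eventually_exists_mem_pspec {a : ℤ → ℂ} {T : SeqSpace →L[ℂ] SeqSpace}
    (hT : IsToeplitz a T) {ε : ℝ}
    (hε : 0 < ε ∨ ((∀ j : ℤ, a (-j) = (starRingEnd ℂ) (a j)) ∧ 0 ≤ ε)) {z : ℂ}
    (hz : z ∈ pspecOp ε T) {δ : ℝ} (hδ : 0 < δ) :
    ∀ᶠ M in Filter.atTop, ∃ u ∈ pspec ε (ToepM a M), dist z u ≤ δ := by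
  have hz' : lowerNorm (T - z • (1 : SeqSpace →L[ℂ] SeqSpace)) ≤ ε := hz
  by_cases hpos : 0 < ε
  · rcases hz'.eq_or_lt with heq | hlt
    · obtain ⟨u, v, hu, hv⟩ := exists_norm_lt_near (hpos.trans_eq heq.symm) hδ
      rw [heq] at hv
      filter_upwards [hT.eventually_sval_le hv] with M hM
      exact ⟨u, hM, hu⟩
    · filter_upwards [hT.eventually_sval_le_of_lowerNorm_lt hlt] with M hM
      exact ⟨z, hM, by simpa using hδ.le⟩
  · obtain ⟨hherm, hε0⟩ := hε.resolve_left hpos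
    obtain rfl : ε = 0 := le_antisymm (not_lt.1 hpos) hε0
    have hlt : lowerNorm (T - z • (1 : SeqSpace →L[ℂ] SeqSpace)) < δ / 2 := by linarith
    filter_upwards [hT.eventually_sval_le_of_lowerNorm_lt hlt, Filter.eventually_gt_atTop 0]
      with M hM hM0
    have : Nonempty (Fin M) := ⟨⟨0, hM0⟩⟩
    have hA : (ToepM a M).IsHermitian := by
      ext i j
      simp only [Matrix.conjTranspose_apply, ToepM]
      rw [← neg_sub, hherm]
      simp
    exact exists_mem_pspec_zero_of_isHermitian hA hδ.le (by linarith)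

/-- Two-sided comparison of the pseudospectra of the finite sections with that of the operator. -/
lemma IsToeplitz.exists_pspec_close {a : ℤ → ℂ} {T : SeqSpace →L[ℂ] SeqSpace}
    (hT : IsToeplitz a T) {w : ℕ} (hband : ∀ j : ℤ, (w : ℤ) < |j| → a j = 0) {ε : ℝ}
    (hε : 0 < ε ∨ ((∀ j : ℤ, a (-j) = (starRingEnd ℂ) (a j)) ∧ 0 ≤ ε)) {δ : ℝ} (hδ : 0 < δ) :
    ∃ η > 0, ∃ n₀ : ℕ, ∀ M ≥ n₀,
      (∀ z ∈ pspec (ε + η) (ToepM a M), ∃ u ∈ pspecOp ε T, dist z u ≤ δ) ∧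
      (∀ u ∈ pspecOp ε T, ∃ z ∈ pspec ε (ToepM a M), dist u z ≤ δ) := by
  obtain ⟨η, hη, hclose⟩ := exists_pspecOp_subset_thickening T ε hδ
  obtain ⟨D, -, hD⟩ := hT.exists_lowerNorm_le_sval_add hband
  have hlim : ∀ᶠ M : ℕ in Filter.atTop, D / ((M : ℝ) + 1) < η / 2 := by
    have := (tendsto_one_div_add_atTop_nhds_zero_nat (𝕜 := ℝ)).const_mul D
    rw [mul_zero] at this
    filter_upwards [this.eventually_lt_const (half_pos hη)] with M hM
    rwa [mul_one_div] at hM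
  have hlower : ∀ᶠ M : ℕ in Filter.atTop,
      ∀ u ∈ pspecOp ε T, ∃ z ∈ pspec ε (ToepM a M), dist u z ≤ δ := by
    obtain ⟨t, htsub, htfin, hcover⟩ :=
      (isCompact_pspecOp T ε).finite_cover_balls (half_pos hδ)
    have hall : ∀ᶠ M : ℕ in Filter.atTop,
        ∀ x ∈ t, ∃ z ∈ pspec ε (ToepM a M), dist x z ≤ δ / 2 :=
      (htfin.eventually_all).2 fun x hx =>
        hT.eventually_exists_mem_pspec hε (htsub hx) (half_pos hδ)
    filter_upwards [hall] with M hM u hu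
    obtain ⟨x, hx, hux⟩ := Set.mem_iUnion₂.1 (hcover hu)
    obtain ⟨z, hz, hxz⟩ := hM x hx
    refine ⟨z, hz, (dist_triangle u x z).trans ?_⟩
    have : dist u x < δ / 2 := hux
    linarith
  obtain ⟨n₀, hn₀⟩ := Filter.eventually_atTop.1
    ((hlim.and hlower).and (Filter.eventually_gt_atTop 0))
  refine ⟨η / 2, half_pos hη, n₀, fun M hM => ⟨fun z hz => hclose z ?_, (hn₀ M hM).1.2⟩⟩
  have h1 := hD M (hn₀ M hM).2 z
  have h2 := (hn₀ M hM).1.1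
  have h3 : sval (ToepM a M - z • (1 : Matrix (Fin M) (Fin M) ℂ)) ≤ ε + η / 2 := hz
  change lowerNorm _ ≤ _
  linarith

lemma sval_submatrix_equiv {ι κ : Type*} [Fintype ι] [Fintype κ] [DecidableEq ι] [DecidableEq κ]
    (F : Matrix κ κ ℂ) (e : ι ≃ κ) : sval (F.submatrix e e) = sval F := by
  unfold sval
  congr 1
  ext y
  set L := LinearIsometryEquiv.piLpCongrLeft 2 ℂ ℂ e
  have hL : ∀ x, Matrix.toEuclideanLin F (L x) = L (Matrix.toEuclideanLin (F.submatrix e e) x) := by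
    intro x
    ext k
    simp only [L, Matrix.toLpLin_apply, Matrix.submatrix_mulVec_equiv,
      LinearIsometryEquiv.piLpCongrLeft_apply]
    simp [Equiv.piCongrLeft'_apply, Matrix.mulVec, dotProduct]
  simp only [Set.mem_ofPred_eq, L.surjective.exists, hL, L.norm_map]

lemma pspec_submatrix_equiv {ι κ : Type*} [Fintype ι] [Fintype κ] [DecidableEq ι] [DecidableEq κ]
    (ε : ℝ) (A : Matrix κ κ ℂ) (e : ι ≃ κ) : pspec ε (A.submatrix e e) = pspec ε A := by
  ext z
  change sval _ ≤ ε ↔ sval _ ≤ ε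
  rw [← sval_submatrix_equiv (A - z • (1 : Matrix κ κ ℂ)) e, Matrix.submatrix_sub,
    Matrix.submatrix_smul]
  simp

lemma pspec_mono {ι : Type*} [Fintype ι] [DecidableEq ι] (A : Matrix ι ι ℂ) {s t : ℝ}
    (h : s ≤ t) : pspec s A ⊆ pspec t A := fun _ hz => le_trans (α := ℝ) hz h

lemma opNorm_nonneg {ι κ : Type*} [Fintype ι] [Fintype κ] [DecidableEq κ] (F : Matrix ι κ ℂ) :
    0 ≤ opNorm F :=
  Real.sSup_nonneg fun y hy => by
    obtain ⟨x, -, rfl⟩ := hy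
    exact norm_nonneg _

lemma opNorm_le {ι κ : Type*} [Fintype ι] [Fintype κ] [DecidableEq κ] {F : Matrix ι κ ℂ} {C : ℝ}
    (hC : 0 ≤ C) (h : ∀ x, ‖Matrix.toEuclideanLin F x‖ ≤ C * ‖x‖) : opNorm F ≤ C :=
  Real.sSup_le (fun y hy => by
    obtain ⟨x, hx, rfl⟩ := hy
    simpa [hx] using h x) hC

lemma opNorm_submatrix_le {ι κ ι' κ' : Type*} [Fintype ι] [Fintype κ] [DecidableEq κ]
    [Fintype ι'] [Fintype κ'] [DecidableEq κ'] {A : Matrix ι κ ℂ} {C : ℝ} (hC : 0 ≤ C)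
    (hA : ∀ x, ‖Matrix.toEuclideanLin A x‖ ≤ C * ‖x‖) {r : ι' → ι} {c : κ' → κ}
    (hr : Function.Injective r) (hc : Function.Injective c) : opNorm (A.submatrix r c) ≤ C := by
  refine opNorm_le hC fun x => ?_
  set y : EuclideanSpace ℂ κ := WithLp.toLp 2 (Function.extend c x 0)
  have hy : ∀ k, y (c k) = x k := fun k => hc.extend_apply _ _ _
  have hy0 : ∀ k ∉ Set.range c, y k = 0 := fun k hk => Function.extend_apply' _ _ _ hk
  have hnorm : ‖y‖ = ‖x‖ := by
    rw [← pow_left_inj₀ (norm_nonneg _) (norm_nonneg _) two_ne_zero, EuclideanSpace.norm_sq_eq,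
      EuclideanSpace.norm_sq_eq]
    exact (Fintype.sum_of_injective c hc _ _ (fun k hk => by simp [hy0 k hk])
      fun k => by rw [hy]).symm
  have happ : ∀ i, Matrix.toEuclideanLin (A.submatrix r c) x i = Matrix.toEuclideanLin A y (r i) :=
    fun i => Fintype.sum_of_injective c hc _ _ (fun k hk => mul_eq_zero_of_right _ (hy0 k hk))
      fun k => congrArg (A (r i) (c k) * ·) (hy k).symm
  rw [← hnorm]
  refine le_trans ?_ (hA y)
  rw [← pow_le_pow_iff_left₀ (norm_nonneg _) (norm_nonneg _) two_ne_zero,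
    EuclideanSpace.norm_sq_eq, EuclideanSpace.norm_sq_eq]
  simp only [happ]
  refine (Finset.sum_map Finset.univ ⟨r, hr⟩
    fun k => ‖Matrix.toEuclideanLin A y k‖ ^ 2).symm.trans_le ?_
  exact Finset.sum_le_sum_of_subset_of_nonneg (Finset.subset_univ _) fun _ _ _ => by positivity

lemma IsToeplitz.norm_toepM_le {a : ℤ → ℂ} {T : SeqSpace →L[ℂ] SeqSpace} (hT : IsToeplitz a T)
    (M : ℕ) (x : EuclideanSpace ℂ (Fin M)) :
    ‖Matrix.toEuclideanLin (ToepM a M) x‖ ≤ ‖T‖ * ‖x‖ := by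
  obtain ⟨f, rfl⟩ := exists_vec_eq x
  have h := hT.norm_toepAct_le M 0 f
  rw [← toEuclideanLin_toepM, zero_smul, zero_smul, sub_zero, sub_zero] at h
  exact h.trans ((T.le_opNorm _).trans_eq (by rw [norm_cut]))

lemma opNorm_blocksOf_le {a : ℤ → ℂ} {T : SeqSpace →L[ℂ] SeqSpace} (hT : IsToeplitz a T)
    {M N : ℕ} {m : Fin N → ℕ} (hsum : ∑ i, m i = M) (i j : Fin N) :
    opNorm (blocksOf (ToepM a M) m hsum i j) ≤ ‖T‖ :=
  opNorm_submatrix_le (A := ToepM a M) (norm_nonneg T) (hT.norm_toepM_le M)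
    (r := fun α : Fin (m i) => ⟨offset m i + α, offset_add_lt hsum i α⟩)
    (c := fun β : Fin (m j) => ⟨offset m j + β, offset_add_lt hsum j β⟩)
    (fun α α' h => by simpa [Fin.ext_iff] using h) (fun β β' h => by simpa [Fin.ext_iff] using h)

lemma offset_eq_sum {N : ℕ} (m : Fin N → ℕ) (i : Fin N) :
    offset m i = ∑ j : Fin i, m (Fin.castLE i.isLt.le j) := by
  unfold offset
  refine Eq.trans (Finset.sum_congr ?_ fun _ _ => rfl)
    (Finset.sum_map Finset.univ (Fin.castLEEmb i.isLt.le) m)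
  ext j
  simp only [Finset.mem_filter, Finset.mem_univ, true_and, Finset.mem_map]
  exact ⟨fun h => ⟨⟨j, h⟩, rfl⟩, fun ⟨l, hl⟩ => hl ▸ l.isLt⟩

lemma offset_widx {N n k : ℕ} (m : Fin N → ℕ) (h : k + n ≤ N) (p : Fin n) :
    offset m (widx h p) = ∑ j : Fin k, m (Fin.castLE (by omega) j) +
      ∑ i : Fin p, m (widx h (Fin.castLE p.isLt.le i)) := by
  rw [offset_eq_sum]
  exact Fin.sum_univ_add fun j : Fin (k + p) => m (Fin.castLE (widx h p).isLt.le j)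

lemma offset_add_le {N : ℕ} (m : Fin N → ℕ) {i j : Fin N} (h : j < i) :
    offset m j + m j ≤ offset m i := by
  unfold offset
  rw [add_comm, ← Finset.sum_insert (by simp)]
  refine Finset.sum_le_sum_of_subset fun l hl => ?_
  simp only [Finset.mem_insert, Finset.mem_filter, Finset.mem_univ, true_and] at hl ⊢
  rcases hl with rfl | hl
  · exact h
  · exact hl.trans h

lemma eq_zero_of_bandWidth_lt {a : ℤ → ℂ} {M : ℕ} (i j : Fin M)
    (h : (bandWidth a M : ℤ) < |(i : ℤ) - (j : ℤ)|) : a ((i : ℤ) - (j : ℤ)) = 0 := by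
  have hne : {v : ℕ | ∀ i j : Fin M, (v : ℤ) < |(i : ℤ) - (j : ℤ)| →
      a ((i : ℤ) - (j : ℤ)) = 0}.Nonempty := ⟨M, fun i j hij => by
    have := i.isLt
    have := j.isLt
    rw [lt_abs] at hij
    omega⟩
  exact Nat.sInf_mem hne i j h

lemma offset_add_offset_lt {N v : ℕ} {m : Fin N → ℕ} (hv : ∀ i, v ≤ m i) {i j : Fin N}
    (h : (j : ℕ) + 1 < i) (β : Fin (m j)) : offset m j + β + v < offset m i := by
  have hl : (j : ℕ) + 1 < N := h.trans i.isLt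
  have h1 := offset_add_le m (i := ⟨j + 1, hl⟩) (j := j) (Fin.lt_def.2 (Nat.lt_succ_self _))
  have h2 := offset_add_le m (i := i) (j := ⟨j + 1, hl⟩) h
  have h3 := hv ⟨j + 1, hl⟩
  have h4 := β.isLt
  omega

lemma blocksOf_eq_zero {a : ℤ → ℂ} {M N : ℕ} {m : Fin N → ℕ} (hsum : ∑ i, m i = M)
    (hm : ∀ i, bandWidth a M ≤ m i) {i j : Fin N} (h : ¬|(i : ℤ) - (j : ℤ)| ≤ 1) :
    blocksOf (ToepM a M) m hsum i j = 0 := by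
  ext α β
  refine eq_zero_of_bandWidth_lt _ _ ?_
  rw [not_le, lt_abs] at h
  rw [lt_abs]
  push_cast
  rcases h with h | h
  · have := offset_add_offset_lt hm (i := i) (j := j) (by omega) β
    omega
  · have := offset_add_offset_lt hm (i := j) (j := i) (by omega) α
    omega

lemma triPart_blocksOf {a : ℤ → ℂ} {M N : ℕ} {m : Fin N → ℕ} (hsum : ∑ i, m i = M)
    (hm : ∀ i, bandWidth a M ≤ m i) :
    triPart (blocksOf (ToepM a M) m hsum) = blocksOf (ToepM a M) m hsum := by
  funext i j
  unfold triPart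
  split_ifs with h
  · rfl
  · exact (blocksOf_eq_zero hsum hm h).symm

lemma opNorm_remPart_blocksOf {a : ℤ → ℂ} {M N : ℕ} {m : Fin N → ℕ} (hsum : ∑ i, m i = M)
    (hm : ∀ i, bandWidth a M ≤ m i) :
    opNorm (blockMat m (remPart (blocksOf (ToepM a M) m hsum))) = 0 := by
  have h0 : blockMat m (remPart (blocksOf (ToepM a M) m hsum)) = 0 := by
    ext p q
    unfold blockMat remPart
    split_ifs with h
    · rfl
    · rw [blocksOf_eq_zero hsum hm h]
      rfl
  rw [h0]
  exact le_antisymm (opNorm_le le_rfl fun x => by simp) (opNorm_nonneg _)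

/-- Windows of a banded Toeplitz matrix in block form are again Toeplitz matrices. -/
lemma pspec_window {a : ℤ → ℂ} {M N : ℕ} {m : Fin N → ℕ} (hsum : ∑ i, m i = M)
    (hm : ∀ i, bandWidth a M ≤ m i) (s : ℝ) {n k : ℕ} (h : k + n ≤ N) :
    pspec s (window (triPart (blocksOf (ToepM a M) m hsum)) n k h) =
      pspec s (ToepM a (∑ i, m (widx h i))) := by
  rw [← pspec_submatrix_equiv s (ToepM a (∑ i, m (widx h i)))
    (finSigmaFinEquiv (n := fun i => m (widx h i))), triPart_blocksOf hsum hm]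
  congr 1
  ext p q
  change a _ = a _
  congr 1
  simp only [finSigmaFinEquiv_apply, offset_widx]
  push_cast
  ring

lemma le_sum_widx {N n k : ℕ} {m : Fin N → ℕ} (hm : ∀ i, 0 < m i) (h : k + n ≤ N) :
    n ≤ ∑ i, m (widx h i) := by
  simpa using Finset.card_nsmul_le_sum Finset.univ (fun i => m (widx h i)) 1 fun i _ => hm _

lemma theta_mem_Icc (c : ℝ) (n : ℕ) : theta c n ∈ Set.Icc 0 (Real.pi / ((n : ℝ) + 2)) := by
  have hpos : ∀ t ∈ {t : ℝ | t ∈ Set.Icc (Real.pi / (2 * (n : ℝ) + 1)) (Real.pi / ((n : ℝ) + 2)) ∧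
      2 * Real.sin (t / 2) * Real.cos (((n : ℝ) + 1 / 2) * t)
        + c * Real.sin (((n : ℝ) - 1) * t) = 0}, 0 ≤ t := fun t ht =>
    le_trans (by positivity) ht.1.1
  refine ⟨Real.sInf_nonneg hpos, ?_⟩
  unfold theta
  rcases Set.eq_empty_or_nonempty {t : ℝ |
      t ∈ Set.Icc (Real.pi / (2 * (n : ℝ) + 1)) (Real.pi / ((n : ℝ) + 2)) ∧
      2 * Real.sin (t / 2) * Real.cos (((n : ℝ) + 1 / 2) * t)
        + c * Real.sin (((n : ℝ) - 1) * t) = 0} with h | ⟨t, ht⟩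
  · rw [h, Real.sInf_empty]
    positivity
  · exact (csInf_le ⟨0, hpos⟩ ht).trans ht.1.2

lemma epsTau_blocksOf_mem_Icc {a : ℤ → ℂ} {T : SeqSpace →L[ℂ] SeqSpace} (hT : IsToeplitz a T)
    {M N : ℕ} {m : Fin N → ℕ} (hsum : ∑ i, m i = M) (hm : ∀ i, bandWidth a M ≤ m i) (n : ℕ) :
    epsTau (blocksOf (ToepM a M) m hsum) n ∈ Set.Icc 0 (2 * ‖T‖ * Real.pi / ((n : ℝ) + 2)) := by
  unfold epsTau
  rw [opNorm_remPart_blocksOf hsum hm, add_zero]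
  obtain ⟨h0, h1⟩ := theta_mem_Icc (rL (blocksOf (ToepM a M) m hsum) *
    rU (blocksOf (ToepM a M) m hsum) / (rA (blocksOf (ToepM a M) m hsum)) ^ 2) n
  set t := theta (rL (blocksOf (ToepM a M) m hsum) *
    rU (blocksOf (ToepM a M) m hsum) / (rA (blocksOf (ToepM a M) m hsum)) ^ 2) n
  have hL0 : 0 ≤ rL (blocksOf (ToepM a M) m hsum) := Real.sSup_nonneg fun y hy => by
    obtain ⟨i, j, -, rfl⟩ := hy
    exact opNorm_nonneg _
  have hU0 : 0 ≤ rU (blocksOf (ToepM a M) m hsum) := Real.sSup_nonneg fun y hy => by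
    obtain ⟨i, j, -, rfl⟩ := hy
    exact opNorm_nonneg _
  have hL1 : rL (blocksOf (ToepM a M) m hsum) ≤ ‖T‖ := Real.sSup_le (fun y hy => by
    obtain ⟨i, j, -, rfl⟩ := hy
    exact opNorm_blocksOf_le hT hsum i j) (norm_nonneg T)
  have hU1 : rU (blocksOf (ToepM a M) m hsum) ≤ ‖T‖ := Real.sSup_le (fun y hy => by
    obtain ⟨i, j, -, rfl⟩ := hy
    exact opNorm_blocksOf_le hT hsum i j) (norm_nonneg T)
  have hr0 : 0 ≤ rA (blocksOf (ToepM a M) m hsum) := add_nonneg hL0 hU0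
  have hr1 : rA (blocksOf (ToepM a M) m hsum) ≤ 2 * ‖T‖ := (add_le_add hL1 hU1).trans_eq
    (two_mul _).symm
  have htpi : t ≤ Real.pi :=
    h1.trans (div_le_self Real.pi_pos.le (by linarith [n.cast_nonneg (α := ℝ)]))
  have hs0 : 0 ≤ Real.sin (t / 2) := Real.sin_nonneg_of_nonneg_of_le_pi (by linarith) (by linarith)
  refine ⟨by positivity, ?_⟩
  calc 2 * rA (blocksOf (ToepM a M) m hsum) * Real.sin (t / 2)
      ≤ 2 * (2 * ‖T‖) * (t / 2) := by
        gcongr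
        exact Real.sin_le (by linarith)
    _ = 2 * ‖T‖ * t := by ring
    _ ≤ 2 * ‖T‖ * (Real.pi / ((n : ℝ) + 2)) := by gcongr
    _ = 2 * ‖T‖ * Real.pi / ((n : ℝ) + 2) := by ring

/-- A τ-method inclusion set lies between pseudospectra of Toeplitz matrices of order at least
`n`. -/
lemma SigmaTau_sandwich {a : ℤ → ℂ} {T : SeqSpace →L[ℂ] SeqSpace} (hT : IsToeplitz a T)
    {M N n : ℕ} {m : Fin N → ℕ} (hsum : ∑ i, m i = M) (hpos : ∀ i, 0 < m i)
    (hm : ∀ i, bandWidth a M ≤ m i) (hn : 2 < n) (hnN : n ≤ N) (ε : ℝ) :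
    (∀ z ∈ SigmaTau (blocksOf (ToepM a M) m hsum) n hnN ε, ∃ M' ≥ n,
      z ∈ pspec (ε + 2 * ‖T‖ * Real.pi / (n : ℝ)) (ToepM a M')) ∧
    ∃ M' ≥ n, pspec ε (ToepM a M') ⊆ SigmaTau (blocksOf (ToepM a M) m hsum) n hnN ε := by
  unfold SigmaTau
  rw [if_neg hn.not_ge]
  constructor
  · rintro z ⟨-, hz⟩
    obtain ⟨k, hk⟩ := Set.mem_iUnion.1 hz
    rw [pspec_window hsum hm] at hk
    refine ⟨_, le_sum_widx hpos _, pspec_mono _ ?_ hk⟩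
    have h := (epsTau_blocksOf_mem_Icc hT hsum hm (n - 2)).2
    rw [Nat.cast_sub hn.le, Nat.cast_ofNat, sub_add_cancel] at h
    linarith
  · have hk : (((0 : Fin (N - n + 1)) : ℕ)) + n ≤ N := by simpa using hnN
    refine ⟨_, le_sum_widx hpos hk, fun z hz => ⟨Or.inl ?_, ?_⟩⟩
    · refine Set.mem_iUnion.2 ⟨0, ?_⟩
      rw [pspec_window hsum hm]
      exact pspec_mono _ (le_add_of_nonneg_right (epsTau_blocksOf_mem_Icc hT hsum hm n).1) hz
    · refine Set.mem_iUnion.2 ⟨0, ?_⟩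
      rw [pspec_window hsum hm]
      exact pspec_mono _
        (le_add_of_nonneg_right (epsTau_blocksOf_mem_Icc hT hsum hm (n - 2)).1) hz

/-- The inclusion sets are uniformly close to the pseudospectrum of the operator. -/
lemma IsToeplitz.exists_SigmaTau_close {a : ℤ → ℂ} {T : SeqSpace →L[ℂ] SeqSpace}
    (hT : IsToeplitz a T) {w : ℕ} (hband : ∀ j : ℤ, (w : ℤ) < |j| → a j = 0) {ε : ℝ}
    (hε : 0 < ε ∨ ((∀ j : ℤ, a (-j) = (starRingEnd ℂ) (a j)) ∧ 0 ≤ ε)) {δ : ℝ} (hδ : 0 < δ) :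
    ∃ n₀ : ℕ, ∀ (n M N : ℕ) (m : Fin N → ℕ) (hsum : ∑ i, m i = M) (hnN : n ≤ N),
      n₀ ≤ n → (∀ i, 0 < m i) → (∀ i, bandWidth a M ≤ m i) →
      (∀ z ∈ SigmaTau (blocksOf (ToepM a M) m hsum) n hnN ε, ∃ u ∈ pspecOp ε T, dist z u ≤ δ) ∧
      (∀ u ∈ pspecOp ε T, ∃ z ∈ SigmaTau (blocksOf (ToepM a M) m hsum) n hnN ε,
        dist u z ≤ δ) := by
  obtain ⟨η, hη, n₁, hclose⟩ := hT.exists_pspec_close hband hε hδ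
  have hlim : ∀ᶠ n : ℕ in Filter.atTop, 2 * ‖T‖ * Real.pi / (n : ℝ) < η :=
    (tendsto_const_div_atTop_nhds_zero_nat _).eventually_lt_const hη
  obtain ⟨n₀, hn₀⟩ := Filter.eventually_atTop.1
    ((hlim.and (Filter.eventually_ge_atTop n₁)).and (Filter.eventually_gt_atTop 2))
  refine ⟨n₀, fun n M N m hsum hnN hn hpos hm => ?_⟩
  obtain ⟨⟨hsmall, hn₁⟩, hn2⟩ := hn₀ n hn
  obtain ⟨hupper, M', hM', hlower⟩ := SigmaTau_sandwich hT hsum hpos hm hn2 hnN ε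
  refine ⟨fun z hz => ?_, fun u hu => ?_⟩
  · obtain ⟨K, hK, hzK⟩ := hupper z hz
    exact (hclose K (hn₁.trans hK)).1 z (pspec_mono _ (by linarith) hzK)
  · obtain ⟨z, hz, hdist⟩ := (hclose M' (hn₁.trans hM')).2 u hu
    exact ⟨z, hlower hz, hdist⟩

end SpecIncl

open SpecIncl in
/-- **Theorem 5.4 (sharpness of the τ-method inclusion sets for banded
Toeplitz matrices).** Let `(a_j)` have `a_j = 0` for `|j| > w` and let `T` be
the associated Toeplitz operator `A_∞` on `ℓ²(ℕ)`. Suppose `ε > 0` (or `ε ≥ 0`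
if the symbol is Hermitian, i.e. `a_{−j} = conj(a_j)` for all `j`). Then
(i) `d_H(Spec_ε A_M, Spec_ε A_∞) → 0` as `M → ∞`; (ii) for every `δ > 0` there
is `n₀` such that `d_H(Σ^n_ε(A_M), Spec_ε A_∞) ≤ δ` whenever `n ≥ n₀` and
`A_M` is written in an admissible block form (`m_i ≥ w_M`, `N > n`);
consequently `d_H(Σ^n_ε(A_M), Spec_ε A_M) → 0` as `M, n → ∞` with `N > n`. -/
theorem banded_toeplitz_tau_sharpness (a : ℤ → ℂ) (w : ℕ)
    (hband : ∀ j : ℤ, (w : ℤ) < |j| → a j = 0)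
    (T : lp (fun _ : ℕ => ℂ) 2 →L[ℂ] lp (fun _ : ℕ => ℂ) 2)
    (hT : ∀ (x : lp (fun _ : ℕ => ℂ) 2) (i : ℕ),
      (T x : ℕ → ℂ) i = ∑' j : ℕ, a ((i : ℤ) - (j : ℤ)) * (x : ℕ → ℂ) j)
    (ε : ℝ)
    (hε : 0 < ε ∨ ((∀ j : ℤ, a (-j) = (starRingEnd ℂ) (a j)) ∧ 0 ≤ ε)) :
    Filter.Tendsto
      (fun M : ℕ => Metric.hausdorffDist (pspec ε (ToepM a M)) (pspecOp ε T))
      Filter.atTop (nhds 0) ∧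
    (∀ δ : ℝ, 0 < δ → ∃ n₀ : ℕ,
      ∀ (n M N : ℕ) (m : Fin N → ℕ) (hsum : ∑ i, m i = M)
        (hN : 1 < N) (hnN : n ≤ N - 1),
        n₀ ≤ n → 1 ≤ n → (∀ i, 0 < m i) → (∀ i, bandWidth a M ≤ m i) →
        Metric.hausdorffDist
          (SigmaTau (blocksOf (ToepM a M) m hsum) n (by omega) ε)
          (pspecOp ε T) ≤ δ) ∧
    (∀ δ : ℝ, 0 < δ → ∃ n₀ M₀ : ℕ,
      ∀ (n M N : ℕ) (m : Fin N → ℕ) (hsum : ∑ i, m i = M)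
        (hN : 1 < N) (hnN : n ≤ N - 1),
        n₀ ≤ n → M₀ ≤ M → 1 ≤ n → (∀ i, 0 < m i) → (∀ i, bandWidth a M ≤ m i) →
        Metric.hausdorffDist
          (SigmaTau (blocksOf (ToepM a M) m hsum) n (by omega) ε)
          (pspec ε (ToepM a M)) ≤ δ) := by
  have hT' : IsToeplitz a T := hT
  refine ⟨?_, fun δ hδ => ?_, fun δ hδ => ?_⟩
  · rw [Metric.tendsto_atTop]
    intro δ hδ
    obtain ⟨η, hη, n₀, hclose⟩ := hT'.exists_pspec_close hband hε (half_pos hδ)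
    refine ⟨n₀, fun M hM => ?_⟩
    rw [Real.dist_eq, sub_zero, abs_of_nonneg Metric.hausdorffDist_nonneg]
    refine lt_of_le_of_lt (Metric.hausdorffDist_le_of_mem_dist (half_pos hδ).le (fun z hz => ?_)
      (hclose M hM).2) (half_lt_self hδ)
    exact (hclose M hM).1 z (pspec_mono _ (by linarith) hz)
  · obtain ⟨n₀, hclose⟩ := hT'.exists_SigmaTau_close hband hε hδ
    refine ⟨n₀, fun n M N m hsum hN hnN hn _ hpos hm => ?_⟩
    obtain ⟨h1, h2⟩ := hclose n M N m hsum (by omega) hn hpos hm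
    exact Metric.hausdorffDist_le_of_mem_dist hδ.le h1 h2
  · obtain ⟨n₀, hsigma⟩ := hT'.exists_SigmaTau_close hband hε (half_pos hδ)
    obtain ⟨η, hη, M₀, hclose⟩ := hT'.exists_pspec_close hband hε (half_pos hδ)
    refine ⟨n₀, M₀, fun n M N m hsum hN hnN hn hM _ hpos hm => ?_⟩
    obtain ⟨h1, h2⟩ := hsigma n M N m hsum (by omega) hn hpos hm
    obtain ⟨h3, h4⟩ := hclose M hM
    refine Metric.hausdorffDist_le_of_mem_dist hδ.le (fun z hz => ?_) fun z hz => ?_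
    · obtain ⟨u, hu, hzu⟩ := h1 z hz
      obtain ⟨v, hv, huv⟩ := h4 u hu
      exact ⟨v, hv, (dist_triangle z u v).trans (by linarith)⟩
    · obtain ⟨u, hu, hzu⟩ := h3 z (pspec_mono _ (by linarith) hz)
      obtain ⟨v, hv, huv⟩ := h2 u hu
      exact ⟨v, hv, (dist_triangle z u v).trans (by linarith)⟩
end
end
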